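/- arXiv:1906.11808 — 2 statements merged into one kernel-verified Lean document; each statement's English description precedes it below -/
import Mathlib

section
/- Fix ε ∈ (0, 1/4). For every δ > 0 there is N such that the following holds for all n ≥ N with ε < x(n) < 1/2 − ε. Set r = ⌊n^{x(n)/2}⌋, n′ = n + r·a(n), let A be any integer with μ(n)/2 ≤ A ≤ 2·μ(n), let S₁, …, S_{A+r} be fixed pairwise disjoint a(n)-element subsets of V′ = {1,…,n′}, and let V = V′ ∖ (S₁ ∪ … ∪ S_r). Let H′ be distributed as G(n′,1/2) conditioned on the event that the independent a(n)-sets of the graph are exactly S₁, …, S_{A+r}, and let H be the induced subgraph of H′ on V, regarded as a graph on {1,…,n} via the order-preserving bijection V → {1,…,n}. Then for every set B of graphs on {1,…,n} that is invariant under relabelling of vertices, P(H ∈ B) ≤ (1 + δ) · P( G(n,1/2) ∈ B | {X_a = A} ∩ E ), where X_a is the number of independent a(n)-sets of G(n,1/2) and E is the event that all independent a(n)-sets are pairwise disjoint. -/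
open Filter

/-- A vertex set is independent if it spans no edges of the graph. -/
def IndepSet {n : ℕ} (G : SimpleGraph (Fin n)) (T : Finset (Fin n)) : Prop :=
  ∀ u ∈ T, ∀ v ∈ T, ¬ G.Adj u v

/-- All independent `k`-sets of `G` are pairwise disjoint. -/
def AllDisjoint (n k : ℕ) (G : SimpleGraph (Fin n)) : Prop :=
  ∀ S T : Finset (Fin n), S.card = k → T.card = k →
    IndepSet G S → IndepSet G T → S ≠ T → Disjoint S T

/-- The number of independent `k`-sets of a graph. -/
noncomputable def numIndep (n k : ℕ) (G : SimpleGraph (Fin n)) : ℕ :=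
  Nat.card {T : Finset (Fin n) // T.card = k ∧ IndepSet G T}

/-- The event that the independent `s`-sets of `G` are exactly `S 0, …, S (k-1)`. -/
def ExactIndepSets {n : ℕ} (s : ℕ) {k : ℕ} (S : Fin k → Finset (Fin n))
    (G : SimpleGraph (Fin n)) : Prop :=
  ∀ T : Finset (Fin n), (T.card = s ∧ IndepSet G T) ↔ ∃ i, T = S i

/-- `α₀(n) = 2 log₂ n − 2 log₂ log₂ n + 2 log₂ (e/2) + 1`. -/
noncomputable def alpha0 (n : ℕ) : ℝ :=
  2 * Real.logb 2 n - 2 * Real.logb 2 (Real.logb 2 n)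
    + 2 * Real.logb 2 (Real.exp 1 / 2) + 1

/-- `a(n) = ⌊α₀(n)⌋`. -/
noncomputable def aa (n : ℕ) : ℕ := ⌊alpha0 n⌋₊

/-- `μ(n) = C(n, a(n)) · 2^{−a(n)(a(n)−1)/2}`. -/
noncomputable def mu (n : ℕ) : ℝ :=
  (n.choose (aa n) : ℝ) * (2 : ℝ)⁻¹ ^ ((aa n).choose 2)

/-- `x(n) = log μ(n) / log n`, so that `μ(n) = n^{x(n)}`. -/
noncomputable def xx (n : ℕ) : ℝ := Real.log (mu n) / Real.log n


/-! ### Part 1: first moment and Harris -/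

/-- Number of elements satisfying a predicate. -/
noncomputable def cnt {α : Type*} (P : α → Prop) : ℕ := Nat.card {x // P x}

open Classical in
lemma cnt_eq {α : Type*} [Fintype α] (P : α → Prop) : cnt P = (Finset.univ.filter P).card := by
  unfold cnt
  rw [Nat.card_eq_fintype_card, Fintype.card_subtype]

lemma cnt_mono {α : Type*} [Finite α] {P Q : α → Prop} (h : ∀ x, P x → Q x) : cnt P ≤ cnt Q := by
  classical
  have := Fintype.ofFinite α
  rw [cnt_eq, cnt_eq]
  exact Finset.card_le_card (fun x hx => by simp at hx ⊢; exact h x hx)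

/-- All `S i` are independent. -/
def AllInd {N q : ℕ} (S : Fin q → Finset (Fin N)) (G : SimpleGraph (Fin N)) : Prop :=
  ∀ i, IndepSet G (S i)

/-- The probability that `T` is independent given all `S i` are. -/
noncomputable def wt {N q : ℕ} (k : ℕ) (S : Fin q → Finset (Fin N)) (T : Finset (Fin N)) : ℝ :=
  (∏ i, (2:ℝ) ^ ((T ∩ S i).card.choose 2)) / 2 ^ (k.choose 2)

lemma first_moment_one {N q k : ℕ} (S : Fin q → Finset (Fin N)) (T : Finset (Fin N))
    (hT : T.card = k) :
    (cnt (fun G => AllInd S G ∧ IndepSet G T) : ℝ) ≤ wt k S T * cnt (AllInd S) := by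
  classical
  set ed : Finset (Fin N) → Finset (Sym2 (Fin N)) := fun X => X.offDiag.image Sym2.mk.uncurry with hed
  have hedc : ∀ X, (ed X).card = X.card.choose 2 := fun X => Sym2.card_image_offDiag X
  have hmem : ∀ X u v, s(u,v) ∈ ed X ↔ u ∈ X ∧ v ∈ X ∧ u ≠ v := by
    intro X u v
    simp only [hed, Finset.mem_image, Finset.mem_offDiag, Prod.exists, Function.uncurry]
    constructor
    · rintro ⟨a, b, h, e⟩
      rw [Sym2.eq_iff] at e
      rcases e with ⟨rfl, rfl⟩ | ⟨rfl, rfl⟩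
      · exact h
      · exact ⟨h.2.1, h.1, h.2.2.symm⟩
    · intro h; exact ⟨u, v, h, rfl⟩
  set D := ed T \ Finset.univ.biUnion (fun i => ed (T ∩ S i)) with hD
  have hDcard : k.choose 2 ≤ D.card + ∑ i, (T ∩ S i).card.choose 2 := by
    have h1 := Finset.le_card_sdiff (Finset.univ.biUnion (fun i => ed (T ∩ S i))) (ed T)
    have h2 : (Finset.univ.biUnion (fun i => ed (T ∩ S i))).card ≤ ∑ i, (T ∩ S i).card.choose 2 := by
      refine Finset.card_biUnion_le.trans (Finset.sum_le_sum fun i _ => (hedc _).le)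
    rw [hedc, hT, ← hD] at h1
    omega
  have hmemD : ∀ u v, s(u,v) ∈ D ↔ (u ∈ T ∧ v ∈ T ∧ u ≠ v) ∧ ∀ i, ¬ (u ∈ S i ∧ v ∈ S i) := by
    intro u v
    simp only [hD, Finset.mem_sdiff, Finset.mem_biUnion, Finset.mem_univ, true_and, hmem,
      Finset.mem_inter, not_exists]
    constructor
    · rintro ⟨h, h'⟩; exact ⟨h, fun i hi => h' i ⟨⟨h.1, hi.1⟩, ⟨h.2.1, hi.2⟩, h.2.2⟩⟩
    · rintro ⟨h, h'⟩; exact ⟨h, fun i hi => h' i ⟨hi.1.2, hi.2.1.2⟩⟩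
  have key : cnt (fun G => AllInd S G ∧ IndepSet G T) * 2 ^ D.card ≤ cnt (AllInd S) := by
    rw [cnt_eq, cnt_eq, ← Finset.card_powerset, ← Finset.card_product]
    apply Finset.card_le_card_of_injOn (fun p => p.1 ⊔ SimpleGraph.fromEdgeSet (p.2 : Set (Sym2 (Fin N))))
    · rintro ⟨G, X⟩ h
      simp only [Finset.coe_product, Set.mem_prod, Finset.mem_coe, Finset.mem_filter,
        Finset.mem_univ, true_and, Finset.mem_powerset] at h ⊢
      intro i u hu v hv
      rw [SimpleGraph.sup_adj, SimpleGraph.fromEdgeSet_adj]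
      rintro (h1 | ⟨h1, -⟩)
      · exact h.1.1 i u hu v hv h1
      · exact ((hmemD u v).1 (h.2 h1)).2 i ⟨hu, hv⟩
    · rintro ⟨G, X⟩ h ⟨G', X'⟩ h' e
      simp only [Finset.coe_product, Set.mem_prod, Finset.mem_coe, Finset.mem_filter,
        Finset.mem_univ, true_and, Finset.mem_powerset] at h h' e
      have e' : ∀ u v, (G.Adj u v ∨ (s(u,v) ∈ X ∧ u ≠ v)) ↔ (G'.Adj u v ∨ (s(u,v) ∈ X' ∧ u ≠ v)) := by
        intro u v
        have := congrArg (fun H => H.Adj u v) e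
        simpa [SimpleGraph.sup_adj, SimpleGraph.fromEdgeSet_adj] using this
      have hG : ∀ u v, G.Adj u v → s(u,v) ∉ D := fun u v ha hd =>
        h.1.2 u ((hmemD u v).1 hd).1.1 v ((hmemD u v).1 hd).1.2.1 ha
      have hG' : ∀ u v, G'.Adj u v → s(u,v) ∉ D := fun u v ha hd =>
        h'.1.2 u ((hmemD u v).1 hd).1.1 v ((hmemD u v).1 hd).1.2.1 ha
      have hX : ∀ u v, s(u,v) ∈ X → s(u,v) ∈ D := fun u v hx => h.2 hx
      have hX' : ∀ u v, s(u,v) ∈ X' → s(u,v) ∈ D := fun u v hx => h'.2 hx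
      have hne : ∀ u v, s(u,v) ∈ D → u ≠ v := fun u v hd => ((hmemD u v).1 hd).1.2.2
      refine Prod.ext ?_ ?_
      · ext u v
        have := e' u v
        have := hG u v
        have := hG' u v
        have := hX u v
        have := hX' u v
        tauto
      · ext z
        induction z with | _ u v =>
        have := e' u v
        have := hG u v
        have := hG' u v
        have := hX u v
        have := hX' u v
        have := hne u v
        simp only
        tauto
  have hw : ((2:ℝ) ^ D.card)⁻¹ ≤ wt k S T := by
    unfold wt
    rw [Finset.prod_pow_eq_pow_sum, inv_eq_one_div, div_le_div_iff₀ (by positivity) (by positivity), one_mul,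
      ← pow_add]
    exact pow_le_pow_right₀ (by norm_num) (by omega)
  have key' : (cnt (fun G => AllInd S G ∧ IndepSet G T) : ℝ) * 2 ^ D.card ≤ cnt (AllInd S) := by
    exact_mod_cast key
  calc (cnt (fun G => AllInd S G ∧ IndepSet G T) : ℝ)
      ≤ ((2:ℝ) ^ D.card)⁻¹ * cnt (AllInd S) := by
        rw [inv_mul_eq_div, le_div_iff₀ (by positivity)]; exact key'
    _ ≤ _ := by gcongr

lemma indep_mono {N : ℕ} {G H : SimpleGraph (Fin N)} (h : G ≤ H) {T : Finset (Fin N)}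
    (hT : IndepSet H T) : IndepSet G T := fun u hu v hv ha => hT u hu v hv (h ha)

lemma harris_abs {α : Type*} [DistribLattice α] [Fintype α] (M P Q : α → Prop)
    (hP : ∀ a b, a ≤ b → P a → P b) (hQ : ∀ a b, a ≤ b → Q a → Q b)
    (hM : ∀ a b, M a → M b → M (a ⊓ b) ∧ M (a ⊔ b)) :
    cnt (fun a => M a ∧ P a) * cnt (fun a => M a ∧ Q a) ≤ cnt M * cnt (fun a => M a ∧ (P a ∧ Q a)) := by
  classical
  let ind : (α → Prop) → α → ℕ := fun R a => if R a then 1 else 0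
  have i1 : ∀ R a, R a → ind R a = 1 := fun R a h => if_pos h
  have i0 : ∀ R a, ¬ R a → ind R a = 0 := fun R a h => if_neg h
  have hmon : ∀ R : α → Prop, (∀ a b, a ≤ b → R a → R b) → Monotone (ind R) := by
    intro R hR a b hab
    by_cases h : R a
    · rw [i1 R a h, i1 R b (hR a b hab h)]
    · rw [i0 R a h]; exact Nat.zero_le _
  have h := fkg (α := α) (β := ℕ) (μ := ind M) (f := ind P) (g := ind Q)
    (fun _ => Nat.zero_le _) (fun _ => Nat.zero_le _) (fun _ => Nat.zero_le _)
    (hmon P hP) (hmon Q hQ)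
    (by
      intro a b
      by_cases ha : M a
      · by_cases hb : M b
        · rw [i1 M a ha, i1 M b hb, i1 M _ (hM a b ha hb).1, i1 M _ (hM a b ha hb).2]
        · rw [i0 M b hb, mul_zero]; exact Nat.zero_le _
      · rw [i0 M a ha, zero_mul]; exact Nat.zero_le _)
  have hand : ∀ (R R' : α → Prop) a, ind R a * ind R' a = ind (fun a => R a ∧ R' a) a := by
    intro R R' a
    by_cases h1 : R a <;> by_cases h2 : R' a <;> simp [ind, h1, h2]
  have hsum : ∀ R : α → Prop, cnt R = ∑ a, ind R a := by
    intro R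
    rw [cnt_eq, Finset.card_filter]
  simp only [hand] at h
  simpa only [hsum] using h

lemma harris {N q : ℕ} (S : Fin q → Finset (Fin N)) (P Q : Finset (Fin N) → Prop) :
    cnt (fun G => AllInd S G ∧ ∀ T, P T → ¬ IndepSet G T) *
      cnt (fun G => AllInd S G ∧ ∀ T, Q T → ¬ IndepSet G T) ≤
    cnt (AllInd S) * cnt (fun G => AllInd S G ∧
      ((∀ T, P T → ¬ IndepSet G T) ∧ (∀ T, Q T → ¬ IndepSet G T))) := by
  apply harris_abs
  · exact fun a b hab h T hT hi => h T hT (indep_mono hab hi)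
  · exact fun a b hab h T hT hi => h T hT (indep_mono hab hi)
  · intro G H h h'
    refine ⟨fun i => indep_mono inf_le_left (h i), ?_⟩
    intro i u hu v hv ha
    rcases ha with ha | ha
    · exact h i u hu v hv ha
    · exact h' i u hu v hv ha


/-! ### Part 2: structure -/

lemma union_bound {N q k : ℕ} (S : Fin q → Finset (Fin N)) (bad : Finset (Finset (Fin N)))
    (hbad : ∀ T ∈ bad, T.card = k) (E : ℝ) (hE : ∑ T ∈ bad, wt k S T ≤ E) :
    (1 - E) * cnt (AllInd S) ≤ cnt (fun G => AllInd S G ∧ ∀ T, T ∈ bad → ¬ IndepSet G T) := by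
  classical
  have h1 : cnt (AllInd S) ≤ cnt (fun G => AllInd S G ∧ ∀ T, T ∈ bad → ¬ IndepSet G T) +
      ∑ T ∈ bad, cnt (fun G => AllInd S G ∧ IndepSet G T) := by
    rw [cnt_eq, cnt_eq, Finset.sum_congr rfl (fun T _ => cnt_eq (fun G => AllInd S G ∧ IndepSet G T))]
    have : Finset.univ.filter (AllInd S) ⊆
        Finset.univ.filter (fun G => AllInd S G ∧ ∀ T, T ∈ bad → ¬ IndepSet G T) ∪
        bad.biUnion (fun T => Finset.univ.filter (fun G => AllInd S G ∧ IndepSet G T)) := by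
      intro G hG
      simp only [Finset.mem_filter, Finset.mem_univ, true_and] at hG
      by_cases h : ∀ T, T ∈ bad → ¬ IndepSet G T
      · apply Finset.mem_union_left
        simp only [Finset.mem_filter, Finset.mem_univ, true_and]
        exact ⟨hG, h⟩
      · apply Finset.mem_union_right
        push Not at h
        obtain ⟨T, hT, hi⟩ := h
        simp only [Finset.mem_biUnion, Finset.mem_filter, Finset.mem_univ, true_and]
        exact ⟨T, hT, hG, hi⟩
    refine (Finset.card_le_card this).trans ((Finset.card_union_le _ _).trans
      (Nat.add_le_add (le_of_eq (by congr!)) (Finset.card_biUnion_le.trans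
        (Finset.sum_le_sum fun T _ => le_of_eq (by congr!)))))
  have h2 : (cnt (AllInd S) : ℝ) ≤ cnt (fun G => AllInd S G ∧ ∀ T, T ∈ bad → ¬ IndepSet G T) +
      ∑ T ∈ bad, (cnt (fun G => AllInd S G ∧ IndepSet G T) : ℝ) := by exact_mod_cast h1
  have h3 : ∑ T ∈ bad, (cnt (fun G => AllInd S G ∧ IndepSet G T) : ℝ) ≤ E * cnt (AllInd S) := by
    refine (Finset.sum_le_sum fun T hT => first_moment_one S T (hbad T hT)).trans ?_
    rw [← Finset.sum_mul]
    gcongr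
  linarith

lemma cnt_allInd_pos {N q : ℕ} (S : Fin q → Finset (Fin N)) : 0 < cnt (AllInd S) := by
  classical
  rw [cnt_eq, Finset.card_pos]
  exact ⟨⊥, by simp [AllInd, IndepSet]⟩

lemma exact_lower {N q k : ℕ} (S : Fin q → Finset (Fin N)) (hS : ∀ i, (S i).card = k)
    (V : Finset (Fin N)) (bad : Finset (Finset (Fin N)))
    (hbad : ∀ T, T ∈ bad ↔ T.card = k ∧ (∀ i, T ≠ S i) ∧ ¬ T ⊆ V)
    (E : ℝ) (hE : ∑ T ∈ bad, wt k S T ≤ E) :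
    (1 - E) * cnt (fun G => AllInd S G ∧
      ∀ T, (T.card = k ∧ (∀ i, T ≠ S i) ∧ T ⊆ V) → ¬ IndepSet G T) ≤ cnt (ExactIndepSets k S) := by
  have h1 := union_bound S bad (fun T hT => ((hbad T).1 hT).1) E hE
  have h2 := harris S (fun T => T.card = k ∧ (∀ i, T ≠ S i) ∧ T ⊆ V) (fun T => T ∈ bad)
  have h3 : cnt (fun G => AllInd S G ∧ ((∀ T, (T.card = k ∧ (∀ i, T ≠ S i) ∧ T ⊆ V) → ¬ IndepSet G T) ∧
      (∀ T, T ∈ bad → ¬ IndepSet G T))) ≤ cnt (ExactIndepSets k S) := by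
    apply cnt_mono
    rintro G ⟨ha, hi, ho⟩ T
    constructor
    · rintro ⟨hc, hT⟩
      by_contra hne
      push Not at hne
      by_cases hV : T ⊆ V
      · exact hi T ⟨hc, hne, hV⟩ hT
      · exact ho T ((hbad T).2 ⟨hc, hne, hV⟩) hT
    · rintro ⟨i, rfl⟩; exact ⟨hS i, ha i⟩
  have hpos : (0:ℝ) < cnt (AllInd S) := by exact_mod_cast cnt_allInd_pos S
  set a := cnt (fun G => AllInd S G ∧
      ∀ T, (T.card = k ∧ (∀ i, T ≠ S i) ∧ T ⊆ V) → ¬ IndepSet G T)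
  have h4 : (a : ℝ) * cnt (fun G => AllInd S G ∧ ∀ T, T ∈ bad → ¬ IndepSet G T) ≤
      cnt (AllInd S) * cnt (ExactIndepSets k S) := by
    exact_mod_cast h2.trans (Nat.mul_le_mul_left _ h3)
  have h5 : (a:ℝ) * ((1 - E) * cnt (AllInd S)) ≤ cnt (AllInd S) * cnt (ExactIndepSets k S) :=
    (mul_le_mul_of_nonneg_left h1 (by positivity)).trans h4
  refine le_of_mul_le_mul_left ?_ hpos
  linarith

lemma fiber_count {N n q : ℕ} (S : Fin q → Finset (Fin N)) (e : Fin n ↪ Fin N)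
    (P : SimpleGraph (Fin n) → Prop) :
    cnt (fun H => AllInd S H ∧ P (SimpleGraph.comap e H)) =
      cnt (fun G : SimpleGraph (Fin n) => AllInd S (G.map e) ∧ P G) *
      cnt (fun K => AllInd S K ∧ SimpleGraph.comap e K = ⊥) := by
  classical
  unfold cnt
  rw [← Nat.card_prod]
  symm
  apply Nat.card_congr
  refine ⟨fun p => ⟨p.1.1.map e ⊔ p.2.1, ?_, ?_⟩,
    fun H => ⟨⟨SimpleGraph.comap e H.1, ?_, H.2.2⟩,
      ⟨H.1 \ ((SimpleGraph.comap e H.1).map e), ?_, ?_⟩⟩, ?_, ?_⟩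
  · intro i u hu v hv ha
    rcases ha with ha | ha
    · exact p.1.2.1 i u hu v hv ha
    · exact p.2.2.1 i u hu v hv ha
  · have : SimpleGraph.comap e (p.1.1.map e ⊔ p.2.1) = p.1.1 := by
      have h2 := p.2.2.2
      ext u v
      have h3 : ¬ p.2.1.Adj (e u) (e v) := by
        intro h
        have : (SimpleGraph.comap e p.2.1).Adj u v := h
        rw [h2] at this
        exact this
      simp [h3]
    rw [this]; exact p.1.2.2
  · exact fun i => indep_mono (SimpleGraph.map_comap_le e H.1) (H.2.1 i)
  · exact fun i => indep_mono sdiff_le (H.2.1 i)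
  · ext u v
    simp
  · rintro ⟨⟨G, hG⟩, ⟨K, hK⟩⟩
    have h3 : ∀ u v, ¬ K.Adj (e u) (e v) := by
      intro u v h
      have : (SimpleGraph.comap e K).Adj u v := h
      rw [hK.2] at this
      exact this
    have hc : SimpleGraph.comap e (G.map e ⊔ K) = G := by
      ext u v
      simp [h3]
    refine Prod.ext (Subtype.ext hc) (Subtype.ext ?_)
    simp only [hc]
    ext u v
    simp only [SimpleGraph.sdiff_adj, SimpleGraph.sup_adj, SimpleGraph.map_adj]
    constructor
    · rintro ⟨h | h, h'⟩
      · exact absurd h h'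
      · exact h
    · intro h
      refine ⟨Or.inr h, ?_⟩
      rintro ⟨u', v', -, rfl, rfl⟩
      exact h3 _ _ h
  · rintro ⟨H, hH⟩
    apply Subtype.ext
    simp only
    rw [sup_sdiff_self_right, sup_eq_right]
    exact SimpleGraph.map_comap_le e H

lemma cnt_congr {α : Type*} {P Q : α → Prop} (h : ∀ x, P x ↔ Q x) : cnt P = cnt Q := by
  have : P = Q := funext fun x => propext (h x)
  rw [this]

lemma core_bound {N n A r k : ℕ} (hkpos : 0 < k) (S : Fin (A + r) → Finset (Fin N)) (hS : ∀ i, (S i).card = k)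
    (hdisj : Pairwise (Function.onFun Disjoint S))
    (V : Finset (Fin N)) (hVin : ∀ i : Fin (A + r), r ≤ (i:ℕ) → S i ⊆ V)
    (hVout : ∀ i : Fin (A + r), (i:ℕ) < r → Disjoint (S i) V)
    (e : Fin n ↪ Fin N) (he : ∀ v, v ∈ V ↔ ∃ i, e i = v)
    (bad : Finset (Finset (Fin N)))
    (hbad : ∀ T, T ∈ bad ↔ T.card = k ∧ (∀ i, T ≠ S i) ∧ ¬ T ⊆ V)
    (E : ℝ) (hE : ∑ T ∈ bad, wt k S T ≤ E) (B : SimpleGraph (Fin n) → Prop) :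
    ∃ D : Fin A → Finset (Fin n), (∀ i, (D i).card = k) ∧ Pairwise (Function.onFun Disjoint D) ∧
      ∃ c : ℕ, cnt (fun H => ExactIndepSets k S H ∧ B (SimpleGraph.comap e H)) ≤
          cnt (fun G => ExactIndepSets k D G ∧ B G) * c ∧
        (1 - E) * (cnt (ExactIndepSets k D) * c : ℕ) ≤ cnt (ExactIndepSets k S) := by
  classical
  let j : Fin A → Fin (A + r) := fun i => ⟨r + i, by omega⟩
  let D : Fin A → Finset (Fin n) := fun i => Finset.univ.filter (fun v => e v ∈ S (j i))
  have hDm : ∀ i, (D i).map e = S (j i) := by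
    intro i
    ext v
    simp only [D, Finset.mem_map, Finset.mem_filter, Finset.mem_univ, true_and]
    constructor
    · rintro ⟨u, hu, rfl⟩; exact hu
    · intro hv
      obtain ⟨u, rfl⟩ := (he v).1 (hVin (j i) (by simp [j]) hv)
      exact ⟨u, hv, rfl⟩
  have hmapInd : ∀ (H : SimpleGraph (Fin N)) (X : Finset (Fin n)),
      IndepSet (SimpleGraph.comap e H) X ↔ IndepSet H (X.map e) := by
    intro H X
    constructor
    · intro h u hu v hv ha
      obtain ⟨u', hu', rfl⟩ := Finset.mem_map.1 hu
      obtain ⟨v', hv', rfl⟩ := Finset.mem_map.1 hv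
      exact h u' hu' v' hv' ha
    · intro h u hu v hv ha
      exact h (e u) (Finset.mem_map_of_mem _ hu) (e v) (Finset.mem_map_of_mem _ hv) ha
  have hjsurj : ∀ i : Fin (A + r), r ≤ (i:ℕ) → ∃ i', i = j i' := by
    intro i hi
    exact ⟨⟨i - r, by omega⟩, Fin.ext (by simp [j]; omega)⟩
  have hpre : ∀ T : Finset (Fin N), T ⊆ V → ∃ X : Finset (Fin n), T = X.map e := by
    intro T hT
    refine ⟨Finset.univ.filter (fun v => e v ∈ T), ?_⟩
    ext v
    simp only [Finset.mem_map, Finset.mem_filter, Finset.mem_univ, true_and]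
    constructor
    · intro hv
      obtain ⟨u, rfl⟩ := (he v).1 (hT hv)
      exact ⟨u, hv, rfl⟩
    · rintro ⟨u, hu, rfl⟩; exact hu
  have hmapV : ∀ X : Finset (Fin n), X.map e ⊆ V := by
    intro X v hv
    obtain ⟨u, -, rfl⟩ := Finset.mem_map.1 hv
    exact (he _).2 ⟨u, rfl⟩
  -- exact S restricted
  have hres : ∀ H, (AllInd S H ∧ ∀ T, (T.card = k ∧ (∀ i, T ≠ S i) ∧ T ⊆ V) → ¬ IndepSet H T) ↔
      (AllInd S H ∧ ExactIndepSets k D (SimpleGraph.comap e H)) := by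
    intro H
    refine and_congr_right fun hA => ?_
    constructor
    · intro h X
      rw [hmapInd]
      constructor
      · rintro ⟨hc, hX⟩
        by_contra hne
        push Not at hne
        refine h (X.map e) ⟨by simpa using hc, ?_, hmapV X⟩ hX
        intro i hi
        by_cases hir : r ≤ (i:ℕ)
        · obtain ⟨i', rfl⟩ := hjsurj i hir
          rw [← hDm] at hi
          exact hne i' (Finset.map_injective e hi)
        · have h1 := hVout i (by omega)
          have h2 : Disjoint (X.map e) (X.map e) := by
            rw [← hi] at h1
            exact h1.mono_right (hmapV X)
          rw [disjoint_self, Finset.bot_eq_empty] at h2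
          have : k = 0 := by rw [← hc, ← Finset.card_map e, h2, Finset.card_empty]
          omega
      · rintro ⟨i, rfl⟩
        rw [hDm]
        exact ⟨by rw [← Finset.card_map e, hDm, hS], hA _⟩
    · rintro h T ⟨hc, hne, hTV⟩ hi
      obtain ⟨X, rfl⟩ := hpre T hTV
      obtain ⟨i, rfl⟩ := (h X).1 ⟨by simpa using hc, (hmapInd H X).2 hi⟩
      exact hne _ (hDm i)
  have hexD : ∀ G : SimpleGraph (Fin n), ExactIndepSets k D G → AllInd S (G.map e) := by
    intro G hG i u hu v hv ha
    rw [SimpleGraph.map_adj] at ha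
    obtain ⟨u', v', ha, rfl, rfl⟩ := ha
    by_cases hir : r ≤ (i:ℕ)
    · obtain ⟨i', rfl⟩ := hjsurj i hir
      exact ((hG (D i')).2 ⟨i', rfl⟩).2 u' (by simpa [D] using hu) v' (by simpa [D] using hv) ha
    · exact Finset.disjoint_left.1 (hVout i (by omega)) hu ((he _).2 ⟨u', rfl⟩)
  have hfib : ∀ P : SimpleGraph (Fin n) → Prop,
      cnt (fun H => AllInd S H ∧ (ExactIndepSets k D (SimpleGraph.comap e H) ∧ P (SimpleGraph.comap e H))) =
      cnt (fun G => ExactIndepSets k D G ∧ P G) *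
        cnt (fun K => AllInd S K ∧ SimpleGraph.comap e K = ⊥) := by
    intro P
    rw [fiber_count S e (fun G => ExactIndepSets k D G ∧ P G)]
    congr 1
    exact cnt_congr fun G => ⟨fun h => h.2, fun h => ⟨hexD G h.1, h⟩⟩
  refine ⟨D, ?_, ?_, cnt (fun K => AllInd S K ∧ SimpleGraph.comap e K = ⊥), ?_, ?_⟩
  · intro i; rw [← Finset.card_map e, hDm, hS]
  · intro i i' hne
    have := hdisj (show j i ≠ j i' from fun h => hne (Fin.ext (by simpa [j] using h)))
    simp only [Function.onFun, ← hDm, Finset.disjoint_map] at this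
    exact this
  · rw [← hfib B]
    apply cnt_mono
    rintro H ⟨h1, h2⟩
    have hA : AllInd S H := fun i => ((h1 (S i)).2 ⟨i, rfl⟩).2
    refine ⟨hA, ((hres H).1 ⟨hA, ?_⟩).2, h2⟩
    rintro T ⟨hc, hne, -⟩ hi
    obtain ⟨i, hi⟩ := (h1 T).1 ⟨hc, hi⟩
    exact hne i hi
  · have := hfib (fun _ => True)
    simp only [and_true] at this
    rw [← this, ← cnt_congr hres]
    exact exact_lower S hS V bad hbad E hE


/-! ### Part 3: symmetry -/

lemma exists_perm {n A k : ℕ} (D D' : Fin A → Finset (Fin n)) (hD : ∀ i, (D i).card = k)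
    (hD' : ∀ i, (D' i).card = k) (hd : Pairwise (Function.onFun Disjoint D))
    (hd' : Pairwise (Function.onFun Disjoint D')) :
    ∃ π : Equiv.Perm (Fin n), ∀ i v, v ∈ D i ↔ π v ∈ D' i := by
  classical
  have hcol : ∀ D : Fin A → Finset (Fin n), (∀ i, (D i).card = k) →
      Pairwise (Function.onFun Disjoint D) → ∃ c : Fin n → Option (Fin A),
      (∀ i v, c v = some i ↔ v ∈ D i) ∧ (∀ o, Fintype.card {v // c v = o} =
        match o with
        | some _ => k
        | none => n - A * k) := by
    intro D hD hd
    let c : Fin n → Option (Fin A) := fun v =>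
      if h : ∃ i, v ∈ D i then some h.choose else none
    have hc : ∀ i v, c v = some i ↔ v ∈ D i := by
      intro i v
      simp only [c]
      split_ifs with h
      · constructor
        · intro h'
          rw [Option.some.injEq] at h'
          rw [← h']; exact h.choose_spec
        · intro hv
          by_contra hne
          rw [Option.some.injEq] at hne
          exact Finset.disjoint_left.1 (hd hne) h.choose_spec hv
      · constructor
        · intro h'; cases h'
        · intro hv; exact absurd ⟨i, hv⟩ h
    refine ⟨c, hc, ?_⟩
    rintro (_ | i)
    · have h1 : Finset.univ.filter (fun v => c v = none) = Finset.univ \ Finset.univ.biUnion D := by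
        ext v
        simp only [Finset.mem_filter, Finset.mem_univ, true_and, Finset.mem_sdiff,
          Finset.mem_biUnion]
        rw [Option.eq_none_iff_forall_ne_some]
        simp only [ne_eq, hc, not_exists]
      rw [Fintype.card_subtype, h1, Finset.card_sdiff_of_subset (Finset.subset_univ _),
        Finset.card_biUnion (fun i _ j _ hij => hd hij)]
      simp [hD]
    · rw [Fintype.card_subtype]
      simp only [hc, Finset.filter_univ_mem, hD]
  obtain ⟨c, hc, hcc⟩ := hcol D hD hd
  obtain ⟨c', hc', hcc'⟩ := hcol D' hD' hd'
  let f : ∀ o, {v // c v = o} ≃ {v // c' v = o} := fun o =>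
    Fintype.equivOfCardEq ((hcc o).trans (hcc' o).symm)
  refine ⟨Equiv.ofFiberEquiv f, fun i v => ?_⟩
  rw [← hc, ← hc', Equiv.ofFiberEquiv_map f]

lemma indep_map_perm {n : ℕ} (π : Equiv.Perm (Fin n)) (G : SimpleGraph (Fin n))
    (T : Finset (Fin n)) :
    IndepSet (G.map π.toEmbedding) (T.map π.toEmbedding) ↔ IndepSet G T := by
  constructor
  · intro h u hu v hv ha
    exact h (π u) (Finset.mem_map_of_mem π.toEmbedding hu) (π v)
      (Finset.mem_map_of_mem π.toEmbedding hv)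
      ((SimpleGraph.map_adj π.toEmbedding G _ _).2 ⟨u, v, ha, rfl, rfl⟩)
  · intro h u hu v hv ha
    obtain ⟨u', v', ha', rfl, rfl⟩ := (SimpleGraph.map_adj π.toEmbedding G _ _).1 ha
    exact h u' (by simpa using hu) v' (by simpa using hv) ha'

lemma exact_map_perm {n A k : ℕ} (D D' : Fin A → Finset (Fin n)) (π : Equiv.Perm (Fin n))
    (hπ : ∀ i, (D i).map π.toEmbedding = D' i) (G : SimpleGraph (Fin n)) :
    ExactIndepSets k D' (G.map π.toEmbedding) ↔ ExactIndepSets k D G := by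
  constructor
  · intro h T
    rw [← indep_map_perm π, ← Finset.card_map π.toEmbedding, h]
    simp only [← hπ, (Finset.map_injective _).eq_iff]
  · intro h T
    obtain ⟨T', rfl⟩ : ∃ T', T = T'.map π.toEmbedding :=
      ⟨T.map π.symm.toEmbedding, by ext v; simp⟩
    rw [indep_map_perm π, Finset.card_map π.toEmbedding, h]
    simp only [← hπ, (Finset.map_injective _).eq_iff]

lemma cnt_exact_eq {n A k : ℕ} (D D' : Fin A → Finset (Fin n)) (hD : ∀ i, (D i).card = k)
    (hD' : ∀ i, (D' i).card = k) (hd : Pairwise (Function.onFun Disjoint D))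
    (hd' : Pairwise (Function.onFun Disjoint D')) (B : SimpleGraph (Fin n) → Prop)
    (hB : ∀ (π : Equiv.Perm (Fin n)) (G : SimpleGraph (Fin n)), B G ↔ B (G.map π.toEmbedding)) :
    cnt (fun G => ExactIndepSets k D G ∧ B G) = cnt (fun G => ExactIndepSets k D' G ∧ B G) := by
  obtain ⟨π, hπ⟩ := exists_perm D D' hD hD' hd hd'
  have hπ' : ∀ i, (D i).map π.toEmbedding = D' i := by
    intro i
    ext v
    simp only [Finset.mem_map_equiv, hπ, Equiv.apply_symm_apply]
  unfold cnt
  refine Nat.card_congr (Equiv.subtypeEquiv (π.simpleGraph) ?_)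
  intro G
  have : π.simpleGraph G = G.map π.toEmbedding := by
    ext u v
    rw [SimpleGraph.map_adj π.toEmbedding]
    simp only [Equiv.simpleGraph_apply, SimpleGraph.comap_adj]
    constructor
    · intro h; exact ⟨_, _, h, by simp, by simp⟩
    · rintro ⟨u', v', h, rfl, rfl⟩; simpa using h
  rw [this, exact_map_perm D D' π hπ', ← hB π G]

lemma symm_count {n A k : ℕ} (hk : 0 < k) (D : Fin A → Finset (Fin n)) (hD : ∀ i, (D i).card = k)
    (hd : Pairwise (Function.onFun Disjoint D)) :
    ∃ M : ℕ, 0 < M ∧ ∀ B : SimpleGraph (Fin n) → Prop,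
    (∀ (π : Equiv.Perm (Fin n)) (G : SimpleGraph (Fin n)), B G ↔ B (G.map π.toEmbedding)) →
    cnt (fun G => (numIndep n k G = A ∧ AllDisjoint n k G) ∧ B G) =
      M * cnt (fun G => ExactIndepSets k D G ∧ B G) := by
  classical
  let fam : SimpleGraph (Fin n) → Finset (Finset (Fin n)) := fun G =>
    Finset.univ.filter (fun T => T.card = k ∧ IndepSet G T)
  let Vf : Finset (Finset (Finset (Fin n))) := Finset.univ.filter (fun F => F.card = A ∧
    (∀ T ∈ F, T.card = k) ∧ ∀ T ∈ F, ∀ T' ∈ F, T ≠ T' → Disjoint T T')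
  have hinj : ∀ D : Fin A → Finset (Fin n), (∀ i, (D i).card = k) →
    Pairwise (Function.onFun Disjoint D) → Function.Injective D := by
    intro D hD hd i j hij
    by_contra hne
    have h := hd hne
    simp only [Function.onFun, hij, disjoint_self, Finset.bot_eq_empty] at h
    have := hD j
    rw [h, Finset.card_empty] at this
    omega
  have hnum : ∀ G, numIndep n k G = (fam G).card := by
    intro G
    unfold numIndep
    rw [Nat.card_eq_fintype_card, Fintype.card_subtype]
  have hev : ∀ G, (numIndep n k G = A ∧ AllDisjoint n k G) ↔ fam G ∈ Vf := by
    intro G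
    rw [hnum]
    simp only [Vf, Finset.mem_filter, Finset.mem_univ, true_and]
    refine and_congr_right fun _ => ?_
    constructor
    · intro h
      refine ⟨fun T hT => (Finset.mem_filter.1 hT).2.1, fun T hT T' hT' hne => ?_⟩
      have h1 := (Finset.mem_filter.1 hT).2
      have h2 := (Finset.mem_filter.1 hT').2
      exact h T T' h1.1 h2.1 h1.2 h2.2 hne
    · rintro ⟨-, h⟩ T T' h1 h2 h3 h4 hne
      exact h T (by simp [fam, h1, h3]) T' (by simp [fam, h2, h4]) hne
  refine ⟨Vf.card, Finset.card_pos.2 ⟨Finset.univ.image D, ?_⟩, fun B hB => ?_⟩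
  · simp only [Vf, Finset.mem_filter, Finset.mem_univ, true_and, Finset.mem_image,
      forall_exists_index, forall_apply_eq_imp_iff]
    refine ⟨?_, hD, fun i j hne => hd (fun h => hne (by rw [h]))⟩
    rw [Finset.card_image_of_injective _ (hinj D hD hd)]
    simp
  · rw [cnt_eq]
    rw [Finset.card_eq_sum_card_fiberwise (f := fam) (t := Vf)]
    · rw [← smul_eq_mul, ← Finset.sum_const]
      refine Finset.sum_congr rfl fun F hF => ?_
      simp only [Vf, Finset.mem_filter, Finset.mem_univ, true_and] at hF
      let en := (F.equivFinOfCardEq hF.1).symm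
      let D' : Fin A → Finset (Fin n) := fun i => (en i : Finset (Fin n))
      have hD'1 : ∀ i, (D' i).card = k := fun i => hF.2.1 _ (en i).2
      have hD'2 : Pairwise (Function.onFun Disjoint D') := by
        intro i j hij
        refine hF.2.2 _ (en i).2 _ (en j).2 ?_
        intro h
        exact hij (en.injective (Subtype.ext h))
      rw [cnt_exact_eq D D' hD hD'1 hd hD'2 B hB, cnt_eq]
      congr 1
      ext G
      simp only [Finset.mem_filter, Finset.mem_univ, true_and]
      have hex : ExactIndepSets k D' G ↔ fam G = F := by
        have hmem : ∀ T, (∃ i, T = D' i) ↔ T ∈ F := by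
          intro T
          constructor
          · rintro ⟨i, rfl⟩; exact (en i).2
          · intro hT
            obtain ⟨i, hi⟩ := en.surjective ⟨T, hT⟩
            exact ⟨i, by simp [D', hi]⟩
        simp only [ExactIndepSets, hmem]
        rw [Finset.ext_iff]
        simp only [fam, Finset.mem_filter, Finset.mem_univ, true_and]
      rw [hex, hev]
      constructor
      · rintro ⟨⟨h1, h2⟩, h3⟩; exact ⟨h3, h2⟩
      · rintro ⟨h3, h2⟩
        refine ⟨⟨?_, h2⟩, h3⟩
        rw [h3]; simp only [Vf, Finset.mem_filter, Finset.mem_univ, true_and]; exact hF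
    · intro G hG
      simp only [Finset.coe_filter, Finset.mem_univ, true_and, Set.mem_ofPred_eq] at hG
      exact (hev G).1 hG.1

/-- The combinatorial conclusion, given a bound `E` on the first moment of bad sets. -/
lemma main_comb {N n A r k : ℕ} (hkpos : 0 < k) (S : Fin (A + r) → Finset (Fin N))
    (hS : ∀ i, (S i).card = k)
    (hdisj : Pairwise (Function.onFun Disjoint S))
    (V : Finset (Fin N)) (hVin : ∀ i : Fin (A + r), r ≤ (i:ℕ) → S i ⊆ V)
    (hVout : ∀ i : Fin (A + r), (i:ℕ) < r → Disjoint (S i) V)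
    (e : Fin n ↪ Fin N) (he : ∀ v, v ∈ V ↔ ∃ i, e i = v)
    (bad : Finset (Finset (Fin N)))
    (hbad : ∀ T, T ∈ bad ↔ T.card = k ∧ (∀ i, T ≠ S i) ∧ ¬ T ⊆ V)
    (E δ : ℝ) (hE : ∑ T ∈ bad, wt k S T ≤ E) (hE1 : E < 1) (hEδ : 1 ≤ (1 + δ) * (1 - E))
    (B : SimpleGraph (Fin n) → Prop)
    (hB : ∀ (π : Equiv.Perm (Fin n)) (G : SimpleGraph (Fin n)), B G ↔ B (G.map π.toEmbedding)) :
    (cnt (fun H => ExactIndepSets k S H ∧ B (SimpleGraph.comap e H)) : ℝ) /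
      cnt (ExactIndepSets k S) ≤ (1 + δ) *
      ((cnt (fun G => (numIndep n k G = A ∧ AllDisjoint n k G) ∧ B G) : ℝ) /
        cnt (fun G => numIndep n k G = A ∧ AllDisjoint n k G)) := by
  obtain ⟨D, hD, hd, c, h1, h2⟩ := core_bound hkpos S hS hdisj V hVin hVout e he bad hbad E hE B
  obtain ⟨M, hM, hsym⟩ := symm_count hkpos D hD hd
  have h3 := hsym B hB
  have h4 := hsym (fun _ => True) (fun _ _ => Iff.rfl)
  simp only [and_true] at h4
  rw [h3, h4]
  have h5 : cnt (fun G => ExactIndepSets k D G ∧ B G) ≤ cnt (ExactIndepSets k D) :=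
    cnt_mono fun _ h => h.1
  set b := cnt (fun G => ExactIndepSets k D G ∧ B G)
  set d := cnt (ExactIndepSets k D)
  set x := cnt (fun H => ExactIndepSets k S H ∧ B (SimpleGraph.comap e H))
  set y := cnt (ExactIndepSets k S)
  have hδ : 0 < 1 + δ := by
    by_contra h
    nlinarith
  rcases Nat.eq_zero_or_pos x with hx | hx
  · rw [hx]
    simp only [Nat.cast_zero, zero_div]
    positivity
  have hbc : 0 < b * c := lt_of_lt_of_le hx h1
  have hb : 0 < b := Nat.pos_of_mul_pos_right hbc
  have hc : 0 < c := Nat.pos_of_mul_pos_left hbc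
  have hd0 : 0 < d := lt_of_lt_of_le hb h5
  have hy : (0:ℝ) < y := lt_of_lt_of_le (by have : 0 < 1 - E := by linarith
                                            positivity) h2
  have h1' : (x:ℝ) ≤ b * c := by exact_mod_cast h1
  have hdR : (0:ℝ) < d := by exact_mod_cast hd0
  have hcR : (0:ℝ) < c := by exact_mod_cast hc
  have hbR : (0:ℝ) < b := by exact_mod_cast hb
  have hMR : (0:ℝ) < M := by exact_mod_cast hM
  push_cast at h2 ⊢
  rw [mul_div_mul_left _ _ hMR.ne', div_le_iff₀ hy]
  have h6 : (1 + δ) * (b / d : ℝ) * ((1 - E) * (d * c)) ≤ (1 + δ) * (b / d : ℝ) * y :=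
    mul_le_mul_of_nonneg_left h2 (by positivity)
  have h7 : (1 + δ) * (b / d : ℝ) * ((1 - E) * (d * c)) = ((1 + δ) * (1 - E)) * (b * c) := by
    field_simp
  have h8 : (b * c : ℝ) ≤ ((1 + δ) * (1 - E)) * (b * c) := le_mul_of_one_le_left (by positivity) hEδ
  linarith


/-! ### Part 4: the first moment sum -/

lemma choose_two_add (a b : ℕ) : (a + b).choose 2 = a.choose 2 + b.choose 2 + a * b := by
  induction b with
  | zero => simp
  | succ b ih =>
    rw [← add_assoc, Nat.choose_succ_succ' (a + b) 1, Nat.choose_succ_succ' b 1, ih]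
    simp
    ring

lemma sum_choose_two_le {ι : Type*} (s : Finset ι) (t : ι → ℕ) :
    ∑ i ∈ s, (t i).choose 2 ≤ (∑ i ∈ s, t i).choose 2 := by
  classical
  induction s using Finset.induction_on with
  | empty => simp
  | insert a s ha ih =>
    rw [Finset.sum_insert ha, Finset.sum_insert ha, choose_two_add]
    omega

lemma wt_eq {N q : ℕ} (k : ℕ) (S : Fin q → Finset (Fin N)) (T : Finset (Fin N)) :
    wt k S T = 2 ^ (∑ i, (T ∩ S i).card.choose 2) / 2 ^ (k.choose 2) := by
  unfold wt
  rw [Finset.prod_pow_eq_pow_sum]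

lemma wt_nonneg {N q : ℕ} (k : ℕ) (S : Fin q → Finset (Fin N)) (T : Finset (Fin N)) :
    0 ≤ wt k S T := by
  rw [wt_eq]; positivity

lemma sum_class1 {N q k : ℕ} (S : Fin q → Finset (Fin N)) (U : Finset (Fin N))
    (C : Finset (Finset (Fin N)))
    (hC : ∀ T ∈ C, T.card = k ∧ (∃ v ∈ T, v ∈ U) ∧ ∀ i, (T ∩ S i).card < 2) :
    ∑ T ∈ C, wt k S T ≤ U.card * N.choose (k - 1) / 2 ^ (k.choose 2) := by
  classical
  have h1 : ∀ T ∈ C, wt k S T = 1 / 2 ^ (k.choose 2) := by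
    intro T hT
    rw [wt_eq, Finset.sum_eq_zero, pow_zero]
    intro i _
    exact Nat.choose_eq_zero_of_lt ((hC T hT).2.2 i)
  rw [Finset.sum_congr rfl h1, Finset.sum_const, nsmul_eq_mul, mul_one_div]
  have h2 : C ⊆ (U ×ˢ Finset.powersetCard (k - 1) (Finset.univ : Finset (Fin N))).image
      (fun p => insert p.1 p.2) := by
    intro T hT
    obtain ⟨hc, ⟨v, hv, hvU⟩, -⟩ := hC T hT
    rw [Finset.mem_image]
    refine ⟨(v, T.erase v), ?_, Finset.insert_erase hv⟩
    simp [hvU, Finset.card_erase_of_mem hv, hc]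
  have h3 : C.card ≤ U.card * N.choose (k - 1) := by
    refine (Finset.card_le_card h2).trans (Finset.card_image_le.trans ?_)
    rw [Finset.card_product, Finset.card_powersetCard]
    simp
  gcongr
  exact_mod_cast h3

lemma sum_class3_one {N q k s : ℕ} (hs : s ≤ k) (S : Fin q → Finset (Fin N))
    (hS : ∀ i, (S i).card = k) (hdisj : Pairwise (Function.onFun Disjoint S)) (i : Fin q)
    (C : Finset (Finset (Fin N)))
    (hC : ∀ T ∈ C, T.card = k ∧ (T ∩ S i).card = k - s) :
    ∑ T ∈ C, wt k S T ≤ ((k * N : ℕ) : ℝ) ^ s / 2 ^ (s * (k - s)) := by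
  classical
  have hch : k.choose 2 = (k - s).choose 2 + s.choose 2 + s * (k - s) := by
    have := choose_two_add (k - s) s
    rw [Nat.sub_add_cancel hs] at this
    rw [this]; ring
  have h1 : ∀ T ∈ C, wt k S T ≤ 1 / 2 ^ (s * (k - s)) := by
    intro T hT
    obtain ⟨hc, hi⟩ := hC T hT
    rw [wt_eq, div_le_div_iff₀ (by positivity) (by positivity), one_mul, ← pow_add]
    apply pow_le_pow_right₀ (by norm_num)
    rw [hch, ← Finset.add_sum_erase _ _ (Finset.mem_univ i), hi]
    have h2 : ∑ j ∈ Finset.univ.erase i, (T ∩ S j).card.choose 2 ≤ s.choose 2 := by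
      refine (sum_choose_two_le _ _).trans (Nat.choose_le_choose 2 ?_)
      rw [← Finset.card_biUnion]
      · have : (Finset.univ.erase i).biUnion (fun j => T ∩ S j) ⊆ T \ S i := by
          intro v hv
          simp only [Finset.mem_biUnion, Finset.mem_erase, Finset.mem_univ, and_true,
            Finset.mem_inter] at hv
          obtain ⟨j, hj, hvT, hvS⟩ := hv
          rw [Finset.mem_sdiff]
          exact ⟨hvT, Finset.disjoint_left.1 (hdisj hj) hvS⟩
        refine (Finset.card_le_card this).trans ?_
        have := Finset.card_sdiff_add_card_inter T (S i)
        omega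
      · intro a _ b _ hab
        exact (hdisj hab).mono Finset.inter_subset_right Finset.inter_subset_right
    omega
  refine (Finset.sum_le_sum h1).trans ?_
  rw [Finset.sum_const, nsmul_eq_mul, mul_one_div]
  have h2 : C ⊆ (Finset.powersetCard s (S i) ×ˢ Finset.powersetCard s (Finset.univ : Finset (Fin N))).image
      (fun p => (S i \ p.1) ∪ p.2) := by
    intro T hT
    obtain ⟨hc, hi⟩ := hC T hT
    rw [Finset.mem_image]
    refine ⟨(S i \ T, T \ S i), ?_, ?_⟩
    · have e1 := Finset.card_sdiff_add_card_inter T (S i)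
      have e2 := Finset.card_sdiff_add_card_inter (S i) T
      rw [Finset.inter_comm, hS] at e2
      simp only [Finset.mem_product, Finset.mem_powersetCard, Finset.sdiff_subset, true_and,
        Finset.subset_univ]
      omega
    · ext v
      simp only [Finset.mem_union, Finset.mem_sdiff]
      tauto
  have h3 : C.card ≤ (k * N) ^ s := by
    refine (Finset.card_le_card h2).trans (Finset.card_image_le.trans ?_)
    rw [Finset.card_product, Finset.card_powersetCard, Finset.card_powersetCard, hS, mul_pow]
    refine Nat.mul_le_mul (Nat.choose_le_pow _ _) ?_
    simpa using Nat.choose_le_pow N s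
  gcongr
  exact_mod_cast h3

lemma sum_class3 {N q k m : ℕ} (S : Fin q → Finset (Fin N))
    (hS : ∀ i, (S i).card = k) (hdisj : Pairwise (Function.onFun Disjoint S))
    (C : Finset (Finset (Fin N))) (y : ℝ) (hy1 : y ≤ 1) (hy0 : 0 ≤ y)
    (hy : ((k * N : ℕ) : ℝ) ≤ y * 2 ^ m)
    (hC : ∀ T ∈ C, T.card = k ∧ (∀ i, T ≠ S i) ∧ ∃ i, m < (T ∩ S i).card) :
    ∑ T ∈ C, wt k S T ≤ q * (k * y) := by
  classical
  have hsub : C ⊆ (Finset.univ : Finset (Fin q)).biUnion (fun i => (Finset.Ico 1 (k - m)).biUnion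
      (fun s => C.filter (fun T => (T ∩ S i).card = k - s))) := by
    intro T hT
    obtain ⟨hc, hne, i, hi⟩ := hC T hT
    simp only [Finset.mem_biUnion, Finset.mem_univ, true_and, Finset.mem_Ico, Finset.mem_filter]
    have h1 : (T ∩ S i).card ≤ k := by
      rw [← hc]; exact Finset.card_le_card Finset.inter_subset_left
    have h2 : (T ∩ S i).card ≠ k := by
      intro h
      have e1 : T ∩ S i = T := Finset.eq_of_subset_of_card_le Finset.inter_subset_left (by omega)
      have e2 : T ∩ S i = S i := Finset.eq_of_subset_of_card_le Finset.inter_subset_right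
        (by rw [hS, h])
      exact hne i (e1.symm.trans e2)
    refine ⟨i, k - (T ∩ S i).card, by omega, hT, by omega⟩
  refine (Finset.sum_le_sum_of_subset_of_nonneg hsub (fun T _ _ => wt_nonneg k S T)).trans ?_
  have hbi : ∀ {ι : Type} (s : Finset ι) (f : ι → Finset (Finset (Fin N))),
      ∑ T ∈ s.biUnion f, wt k S T ≤ ∑ i ∈ s, ∑ T ∈ f i, wt k S T := by
    intro ι s f
    induction s using Finset.induction_on with
    | empty => simp
    | insert a s ha ih =>
      rw [Finset.biUnion_insert, Finset.sum_insert ha]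
      have := Finset.sum_union_inter (s₁ := f a) (s₂ := s.biUnion f) (f := wt k S)
      have h0 : 0 ≤ ∑ T ∈ f a ∩ s.biUnion f, wt k S T :=
        Finset.sum_nonneg fun T _ => wt_nonneg k S T
      linarith
  refine (hbi _ _).trans ?_
  have : ∀ i : Fin q, ∑ T ∈ (Finset.Ico 1 (k - m)).biUnion
      (fun s => C.filter (fun T => (T ∩ S i).card = k - s)), wt k S T ≤ k * y := by
    intro i
    refine (hbi _ _).trans ?_
    have h1 : ∀ s ∈ Finset.Ico 1 (k - m),
        ∑ T ∈ C.filter (fun T => (T ∩ S i).card = k - s), wt k S T ≤ y := by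
      intro s hs
      rw [Finset.mem_Ico] at hs
      refine (sum_class3_one (s := s) (by omega) S hS hdisj i _ (fun T hT => ?_)).trans ?_
      · rw [Finset.mem_filter] at hT
        exact ⟨(hC T hT.1).1, hT.2⟩
      · rw [div_le_iff₀ (by positivity)]
        calc ((k * N : ℕ) : ℝ) ^ s ≤ (y * 2 ^ m) ^ s := by gcongr
          _ = y ^ s * 2 ^ (s * m) := by rw [mul_pow, ← pow_mul, mul_comm m s]
          _ ≤ y * 2 ^ (s * (k - s)) := by
            gcongr
            · exact pow_le_of_le_one hy0 hy1 (by omega)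
            · norm_num
            · omega
    refine (Finset.sum_le_sum h1).trans ?_
    rw [Finset.sum_const, nsmul_eq_mul]
    gcongr
    simp
    omega
  refine (Finset.sum_le_sum fun i _ => this i).trans ?_
  simp

lemma sum_class2 {N q k m : ℕ} (S : Fin q → Finset (Fin N))
    (hS : ∀ i, (S i).card = k) (hdisj : Pairwise (Function.onFun Disjoint S))
    (C : Finset (Finset (Fin N))) (z γ : ℝ) (hz0 : 0 ≤ z) (hγ0 : 0 ≤ γ)
    (hz : ∀ Q ≤ k, (N.choose (k - Q) : ℝ) ≤ N.choose k * z ^ Q)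
    (hγ : ∀ t, 2 ≤ t → t ≤ m → (k:ℝ) ^ t * (2 ^ (t.choose 2) * z ^ t) ≤ γ)
    (hC : ∀ T ∈ C, T.card = k ∧ (∀ i, (T ∩ S i).card ≤ m) ∧ ∃ i, 2 ≤ (T ∩ S i).card) :
    ∑ T ∈ C, wt k S T ≤ N.choose k / 2 ^ (k.choose 2) * ((1 + k * γ) ^ q - 1) := by
  classical
  let p : Finset (Fin N) → Fin q → Finset (Fin N) := fun T i =>
    if 2 ≤ (T ∩ S i).card then T ∩ S i else ∅
  let al : Fin q → Finset (Finset (Fin N)) := fun i =>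
    (S i).powerset.filter (fun R => R.card = 0 ∨ (2 ≤ R.card ∧ R.card ≤ m))
  let g : ℕ → ℝ := fun t => 2 ^ (t.choose 2) * z ^ t
  have hg0 : ∀ t, 0 ≤ g t := fun t => by positivity
  have hpmem : ∀ T ∈ C, p T ∈ (Fintype.piFinset al).erase (fun _ => ∅) := by
    intro T hT
    obtain ⟨hc, hm, i, hi⟩ := hC T hT
    rw [Finset.mem_erase]
    constructor
    · intro h
      have h' := congrFun h i
      simp only [p, if_pos hi] at h'
      rw [h'] at hi
      simp at hi
    · rw [Fintype.mem_piFinset]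
      intro j
      simp only [p, al, Finset.mem_filter, Finset.mem_powerset]
      split_ifs with h
      · exact ⟨Finset.inter_subset_right, Or.inr ⟨h, hm j⟩⟩
      · simp
  have hwt : ∀ T, wt k S T = (∏ i, (2:ℝ) ^ ((p T i).card.choose 2)) / 2 ^ (k.choose 2) := by
    intro T
    unfold wt
    congr 1
    refine Finset.prod_congr rfl fun i _ => ?_
    simp only [p]
    split_ifs with h
    · rfl
    · rw [Nat.choose_eq_zero_of_lt (by omega)]; simp
  have hfib : ∀ P ∈ (Fintype.piFinset al).erase (fun _ => ∅),
      ∑ T ∈ C with p T = P, wt k S T ≤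
        N.choose k / 2 ^ (k.choose 2) * ∏ i, g (P i).card := by
    intro P hP
    have hP' := Fintype.mem_piFinset.1 (Finset.mem_of_mem_erase hP)
    have hPS : ∀ i, P i ⊆ S i := fun i => by
      have := hP' i
      simp only [al, Finset.mem_filter, Finset.mem_powerset] at this
      exact this.1
    have hw : ∀ T ∈ C.filter (fun T => p T = P), wt k S T =
        (∏ i, (2:ℝ) ^ ((P i).card.choose 2)) / 2 ^ (k.choose 2) := by
      intro T hT
      rw [hwt, (Finset.mem_filter.1 hT).2]
    rw [Finset.sum_congr rfl hw, Finset.sum_const, nsmul_eq_mul]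
    have hgp : ∏ i, g (P i).card = (∏ i, (2:ℝ) ^ ((P i).card.choose 2)) * z ^ (∑ i, (P i).card) := by
      simp only [g, Finset.prod_mul_distrib, Finset.prod_pow_eq_pow_sum]
    have hQ : (Finset.univ.biUnion P).card = ∑ i, (P i).card :=
      Finset.card_biUnion fun i _ j _ hij => (hdisj hij).mono (hPS i) (hPS j)
    have hcard : ((C.filter (fun T => p T = P)).card : ℝ) ≤ N.choose k * z ^ (∑ i, (P i).card) := by
      have hsubT : ∀ T, p T = P → Finset.univ.biUnion P ⊆ T := by
        intro T hT v hv
        rw [Finset.mem_biUnion] at hv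
        obtain ⟨i, -, hv⟩ := hv
        rw [← hT] at hv
        simp only [p] at hv
        split_ifs at hv with h
        · exact Finset.mem_of_mem_inter_left hv
        · simp at hv
      rcases (C.filter (fun T => p T = P)).eq_empty_or_nonempty with h0 | ⟨T0, hT0⟩
      · rw [h0]; simp only [Finset.card_empty, Nat.cast_zero]; positivity
      · have hQk : ∑ i, (P i).card ≤ k := by
          rw [Finset.mem_filter] at hT0
          rw [← hQ, ← (hC T0 hT0.1).1]
          exact Finset.card_le_card (hsubT T0 hT0.2)
        refine le_trans ?_ (hz _ hQk)
        have : (C.filter (fun T => p T = P)).card ≤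
            (Finset.powersetCard (k - ∑ i, (P i).card) (Finset.univ : Finset (Fin N))).card := by
          apply Finset.card_le_card_of_injOn (fun T => T \ Finset.univ.biUnion P)
          · intro T hT
            simp only [Finset.coe_filter, Set.mem_ofPred_eq] at hT
            simp only [Finset.mem_coe, Finset.mem_powersetCard, Finset.subset_univ, true_and]
            have : (T \ Finset.univ.biUnion P).card = k - ∑ i, (P i).card := by
              rw [Finset.card_sdiff_of_subset (hsubT T hT.2), hQ, (hC T hT.1).1]
            simpa using this
          · intro T hT T' hT' he
            simp only [Finset.coe_filter, Set.mem_ofPred_eq] at hT hT'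
            simp only at he
            rw [← Finset.sdiff_union_of_subset (hsubT T hT.2), he,
              Finset.sdiff_union_of_subset (hsubT T' hT'.2)]
        rw [Finset.card_powersetCard] at this
        simp only [Finset.card_univ, Fintype.card_fin] at this
        exact_mod_cast this
    rw [hgp]
    calc _ ≤ (N.choose k * z ^ (∑ i, (P i).card)) *
          ((∏ i, (2:ℝ) ^ ((P i).card.choose 2)) / 2 ^ (k.choose 2)) := by
            apply mul_le_mul_of_nonneg_right hcard
            positivity
      _ = _ := by ring
  rw [← Finset.sum_fiberwise_of_maps_to hpmem]
  refine (Finset.sum_le_sum hfib).trans ?_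
  rw [← Finset.mul_sum]
  refine mul_le_mul_of_nonneg_left ?_ (by positivity)
  have hemp : (fun _ => ∅ : Fin q → Finset (Fin N)) ∈ Fintype.piFinset al := by
    rw [Fintype.mem_piFinset]; intro i; simp [al]
  have htot : ∑ P ∈ Fintype.piFinset al, ∏ i, g (P i).card ≤ (1 + k * γ) ^ q := by
    rw [← Finset.prod_univ_sum al (fun _ R => g R.card)]
    have : ∀ i, ∑ R ∈ al i, g R.card ≤ 1 + k * γ := by
      intro i
      simp only [al]
      rw [Finset.sum_filter]
      rw [Finset.sum_powerset_apply_card (fun t => if t = 0 ∨ (2 ≤ t ∧ t ≤ m) then g t else 0), hS,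
        Finset.sum_range_succ']
      simp only [Nat.choose_zero_right, true_or, if_true, one_smul]
      have h2 : ∀ t ∈ Finset.range k, k.choose (t + 1) •
          (if t + 1 = 0 ∨ (2 ≤ t + 1 ∧ t + 1 ≤ m) then g (t + 1) else 0) ≤ γ := by
        intro t _
        by_cases h : t + 1 = 0 ∨ (2 ≤ t + 1 ∧ t + 1 ≤ m)
        · rw [if_pos h]
          have h' : 2 ≤ t + 1 ∧ t + 1 ≤ m := by omega
          refine le_trans ?_ (hγ (t + 1) h'.1 h'.2)
          rw [nsmul_eq_mul]
          refine mul_le_mul_of_nonneg_right ?_ (hg0 _)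
          exact_mod_cast Nat.choose_le_pow k (t + 1)
        · rw [if_neg h]; simpa using hγ0
      have h3 := Finset.sum_le_sum h2
      rw [Finset.sum_const, Finset.card_range, nsmul_eq_mul] at h3
      have h4 : g 0 = 1 := by simp [g]
      rw [h4]; linarith
    refine (Finset.prod_le_prod (fun i _ => Finset.sum_nonneg fun R _ => hg0 _)
      (fun i _ => this i)).trans ?_
    simp
  rw [← Finset.add_sum_erase _ _ hemp] at htot
  have h5 : ∏ i : Fin q, g ((fun _ => ∅ : Fin q → Finset (Fin N)) i).card = 1 := by simp [g]
  rw [h5] at htot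
  linarith

lemma sum_bad {N q k m : ℕ} (S : Fin q → Finset (Fin N))
    (hS : ∀ i, (S i).card = k) (hdisj : Pairwise (Function.onFun Disjoint S))
    (U : Finset (Fin N)) (C : Finset (Finset (Fin N))) (y z γ : ℝ) (hy1 : y ≤ 1) (hy0 : 0 ≤ y)
    (hy : ((k * N : ℕ) : ℝ) ≤ y * 2 ^ m) (hz0 : 0 ≤ z) (hγ0 : 0 ≤ γ)
    (hz : ∀ Q ≤ k, (N.choose (k - Q) : ℝ) ≤ N.choose k * z ^ Q)
    (hγ : ∀ t, 2 ≤ t → t ≤ m → (k:ℝ) ^ t * (2 ^ (t.choose 2) * z ^ t) ≤ γ)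
    (hC : ∀ T ∈ C, T.card = k ∧ (∀ i, T ≠ S i) ∧ ∃ v ∈ T, v ∈ U) :
    ∑ T ∈ C, wt k S T ≤ U.card * N.choose (k - 1) / 2 ^ (k.choose 2) +
      N.choose k / 2 ^ (k.choose 2) * ((1 + k * γ) ^ q - 1) + q * (k * y) := by
  classical
  rw [← Finset.sum_filter_add_sum_filter_not C (fun T => ∃ i, m < (T ∩ S i).card),
    ← Finset.sum_filter_add_sum_filter_not (C.filter (fun T => ¬ ∃ i, m < (T ∩ S i).card))
      (fun T => ∃ i, 2 ≤ (T ∩ S i).card)]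
  have h3 := sum_class3 S hS hdisj (C.filter (fun T => ∃ i, m < (T ∩ S i).card)) y hy1 hy0 hy (by
    intro T hT
    rw [Finset.mem_filter] at hT
    exact ⟨(hC T hT.1).1, (hC T hT.1).2.1, hT.2⟩)
  have h2 := sum_class2 S hS hdisj ((C.filter (fun T => ¬ ∃ i, m < (T ∩ S i).card)).filter
      (fun T => ∃ i, 2 ≤ (T ∩ S i).card)) z γ hz0 hγ0 hz hγ (by
    intro T hT
    simp only [Finset.mem_filter, not_exists, not_lt] at hT
    exact ⟨(hC T hT.1.1).1, hT.1.2, hT.2⟩)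
  have h1 := sum_class1 S U ((C.filter (fun T => ¬ ∃ i, m < (T ∩ S i).card)).filter
      (fun T => ¬ ∃ i, 2 ≤ (T ∩ S i).card)) (by
    intro T hT
    simp only [Finset.mem_filter, not_exists, not_lt, not_le] at hT
    exact ⟨(hC T hT.1.1).1, (hC T hT.1.1).2.2, hT.2⟩)
  linarith


/-! ### Part 5: numerics -/

lemma choose_sub_le {N k : ℕ} {z : ℝ} (hz0 : 0 ≤ z) (hkN : k < N)
    (hz : (k:ℝ) ≤ z * ((N:ℝ) - k)) :
    ∀ Q ≤ k, (N.choose (k - Q) : ℝ) ≤ N.choose k * z ^ Q := by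
  have hpos : (0:ℝ) < (N:ℝ) - k := by
    have : (k:ℝ) < N := by exact_mod_cast hkN
    linarith
  have step : ∀ j, j < k → (N.choose j : ℝ) ≤ N.choose (j + 1) * z := by
    intro j hj
    have h1 : (N.choose (j + 1) : ℝ) * (j + 1) = N.choose j * ((N:ℝ) - j) := by
      have := Nat.choose_succ_right_eq N j
      have h' : ((N - j : ℕ) : ℝ) = (N:ℝ) - j := by
        rw [Nat.cast_sub (by omega)]
      rw [← h']
      exact_mod_cast this
    have hjk : (j:ℝ) + 1 ≤ k := by exact_mod_cast hj
    refine le_of_mul_le_mul_right ?_ hpos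
    calc (N.choose j : ℝ) * ((N:ℝ) - k) ≤ N.choose j * ((N:ℝ) - j) := by
          gcongr
      _ = N.choose (j + 1) * (j + 1) := h1.symm
      _ ≤ N.choose (j + 1) * k := by gcongr
      _ ≤ N.choose (j + 1) * (z * ((N:ℝ) - k)) := by gcongr
      _ = _ := by ring
  intro Q
  induction Q with
  | zero => intro _; simp
  | succ Q ih =>
    intro hQ
    have h1 := ih (by omega)
    have h2 := step (k - (Q + 1)) (by omega)
    rw [show k - (Q + 1) + 1 = k - Q by omega] at h2
    calc (N.choose (k - (Q + 1)) : ℝ) ≤ N.choose (k - Q) * z := h2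
      _ ≤ (N.choose k * z ^ Q) * z := by gcongr
      _ = _ := by ring

lemma choose_add_le {n M k : ℕ} {z : ℝ} (hz0 : 0 ≤ z) (hkN : k < n)
    (hz : (k:ℝ) ≤ z * ((n:ℝ) - k)) (hM : M * z ≤ 1 / 2) :
    ((n + M).choose k : ℝ) ≤ 2 * n.choose k := by
  have h := choose_sub_le hz0 hkN hz
  rw [Nat.add_choose_eq, Finset.Nat.sum_antidiagonal_eq_sum_range_succ_mk, ← Finset.sum_range_reflect]
  push_cast
  have h2 : ∀ j ∈ Finset.range (k + 1), (n.choose (k + 1 - 1 - j) : ℝ) * M.choose (k - (k + 1 - 1 - j)) ≤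
      n.choose k * (1 / 2) ^ j := by
    intro j hj
    rw [Finset.mem_range] at hj
    rw [show k + 1 - 1 - j = k - j by omega, show k - (k - j) = j by omega]
    calc (n.choose (k - j) : ℝ) * M.choose j ≤ (n.choose k * z ^ j) * (M:ℝ) ^ j := by
          gcongr
          · exact h j (by omega)
          · exact_mod_cast Nat.choose_le_pow M j
      _ = n.choose k * (M * z) ^ j := by rw [mul_pow]; ring
      _ ≤ _ := by gcongr
  refine (Finset.sum_le_sum h2).trans ?_
  rw [← Finset.mul_sum, mul_comm (2:ℝ)]
  gcongr
  exact sum_geometric_two_le (k + 1)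

lemma gamma_bound {k m t : ℕ} {w : ℝ} (hw : 2 ^ 136 ≤ w) (hk : (k:ℝ) ≤ w)
    (h2u : (2:ℝ) ^ k ≤ w ^ 1600) (hm : 8 * m ≤ 7 * k + 7) (ht2 : 2 ≤ t) (htm : t ≤ m) :
    (k:ℝ) ^ t * (2 ^ (t.choose 2) * ((w ^ 798)⁻¹) ^ t) ≤ (w ^ 1593)⁻¹ := by
  have hw1 : (1:ℝ) ≤ w := le_trans (by norm_num) hw
  have hw0 : (0:ℝ) < w := by linarith
  by_cases ht : t < 17
  · have h1 : (2:ℝ) ^ (t.choose 2) ≤ w := by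
      refine le_trans (pow_le_pow_right₀ (by norm_num) ?_) hw
      have := Nat.choose_le_choose 2 (show t ≤ 16 by omega)
      refine this.trans (by decide)
    have h2 : (k:ℝ) ^ t * ((w ^ 798)⁻¹) ^ t ≤ (w ^ 1594)⁻¹ := by
      rw [← mul_pow]
      have h3 : (k:ℝ) * (w ^ 798)⁻¹ ≤ (w ^ 797)⁻¹ := by
        calc (k:ℝ) * (w ^ 798)⁻¹ ≤ w * (w ^ 798)⁻¹ := by gcongr
          _ = (w ^ 797)⁻¹ := by field_simp
      calc ((k:ℝ) * (w ^ 798)⁻¹) ^ t ≤ ((w ^ 797)⁻¹) ^ t := by gcongr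
        _ ≤ ((w ^ 797)⁻¹) ^ 2 := by
          apply pow_le_pow_of_le_one (by positivity) _ ht2
          exact inv_le_one_of_one_le₀ (one_le_pow₀ hw1)
        _ = _ := by rw [inv_pow, ← pow_mul]
    calc _ = (2:ℝ) ^ (t.choose 2) * ((k:ℝ) ^ t * ((w ^ 798)⁻¹) ^ t) := by ring
      _ ≤ w * (w ^ 1594)⁻¹ := by gcongr
      _ = (w ^ 1593)⁻¹ := by
        rw [show (1594:ℕ) = 1593 + 1 from rfl, pow_succ]
        field_simp
  · have h1 : (2:ℝ) ^ (t - 1) ≤ w ^ 1400 := by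
      refine le_of_pow_le_pow_left₀ (n := 8) (by norm_num) (by positivity) ?_
      calc ((2:ℝ) ^ (t - 1)) ^ 8 = 2 ^ ((t - 1) * 8) := by rw [pow_mul]
        _ ≤ 2 ^ (k * 7) := pow_le_pow_right₀ (by norm_num) (by omega)
        _ = ((2:ℝ) ^ k) ^ 7 := by rw [pow_mul]
        _ ≤ (w ^ 1600) ^ 7 := by gcongr
        _ = (w ^ 1400) ^ 8 := by rw [← pow_mul, ← pow_mul]
    have h2 : (2:ℝ) ^ (t.choose 2) ≤ (w ^ 700) ^ t := by
      refine le_of_pow_le_pow_left₀ (n := 2) (by norm_num) (by positivity) ?_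
      have : t.choose 2 * 2 = (t - 1) * t := by
        rw [Nat.choose_two_right, Nat.div_mul_cancel (Nat.even_mul_pred_self t).two_dvd]
        ring
      calc ((2:ℝ) ^ (t.choose 2)) ^ 2 = ((2:ℝ) ^ (t - 1)) ^ t := by rw [← pow_mul, this, pow_mul]
        _ ≤ (w ^ 1400) ^ t := by gcongr
        _ = _ := by rw [← pow_mul, ← pow_mul, ← pow_mul]; congr 1; ring
    calc (k:ℝ) ^ t * (2 ^ (t.choose 2) * ((w ^ 798)⁻¹) ^ t)
        ≤ w ^ t * ((w ^ 700) ^ t * ((w ^ 798)⁻¹) ^ t) := by gcongr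
      _ = ((w ^ 97)⁻¹) ^ t := by
        rw [← mul_pow, ← mul_pow]
        congr 1
        field_simp
      _ ≤ ((w ^ 97)⁻¹) ^ 17 := by
        apply pow_le_pow_of_le_one (by positivity) _ (by omega)
        exact inv_le_one_of_one_le₀ (one_le_pow₀ hw1)
      _ = (w ^ 1649)⁻¹ := by rw [inv_pow, ← pow_mul]
      _ ≤ _ := by
        apply inv_anti₀ (by positivity)
        exact pow_le_pow_right₀ hw1 (by norm_num)

lemma numeric {n k r A N : ℕ} {w : ℝ} (hN : N = n + r * k) (hw : 2 ^ 136 ≤ w) (hn : (n:ℝ) = w ^ 800) (hk : (k:ℝ) ≤ w)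
    (h2u : (2:ℝ) ^ k ≤ w ^ 1600) (h2l : w ^ 1598 ≤ (2:ℝ) ^ k)
    (hμ : (n.choose k : ℝ) / 2 ^ (k.choose 2) ≤ w ^ 400) (hr : (r:ℝ) ≤ w ^ 200)
    (hA : (A:ℝ) ≤ 2 * w ^ 400)
    (S : Fin (A + r) → Finset (Fin N))
    (hS : ∀ i, (S i).card = k) (hdisj : Pairwise (Function.onFun Disjoint S))
    (U : Finset (Fin N)) (hU : U.card = r * k) (C : Finset (Finset (Fin N)))
    (hC : ∀ T ∈ C, T.card = k ∧ (∀ i, T ≠ S i) ∧ ∃ v ∈ T, v ∈ U) :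
    ∑ T ∈ C, wt k S T ≤ 3 / w := by
  have hw2 : (100:ℝ) ≤ w := le_trans (by norm_num) hw
  have hw1 : (1:ℝ) ≤ w := le_trans (by norm_num) hw
  have hw0 : (0:ℝ) < w := by linarith
  have hpw : ∀ a b : ℕ, a ≤ b → w ^ a ≤ w ^ b := fun a b h => pow_le_pow_right₀ hw1 h
  set z : ℝ := (w ^ 798)⁻¹ with hzdef
  have hz0 : 0 ≤ z := by positivity
  have hnN : (n:ℝ) ≤ N := by
    rw [hN]; exact_mod_cast Nat.le_add_right n (r * k)
  have hkn : k < n := by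
    have : (k:ℝ) < n := by
      rw [hn]
      calc (k:ℝ) ≤ w := hk
        _ < w ^ 2 := by nlinarith
        _ ≤ w ^ 800 := hpw 2 800 (by norm_num)
    exact_mod_cast this
  have hzn : (k:ℝ) ≤ z * ((n:ℝ) - k) := by
    rw [hzdef, inv_mul_eq_div, le_div_iff₀ (by positivity), hn]
    have h1 : (k:ℝ) * w ^ 798 ≤ w * w ^ 798 := by gcongr
    have h2 : w ≤ w ^ 798 := by simpa using hpw 1 798 (by norm_num)
    have h3 : w ^ 800 = w * w * w ^ 798 := by ring
    nlinarith
  have hzN : (k:ℝ) ≤ z * ((N:ℝ) - k) := hzn.trans (by gcongr)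
  have hrk : ((r * k : ℕ) : ℝ) ≤ w ^ 201 := by
    push_cast
    calc (r:ℝ) * k ≤ w ^ 200 * w := by gcongr
      _ = _ := by ring
  have hCN : ((N.choose k : ℕ) : ℝ) / 2 ^ (k.choose 2) ≤ 2 * w ^ 400 := by
    have := choose_add_le hz0 hkn hzn (M := r * k) (by
      calc ((r * k : ℕ) : ℝ) * z ≤ w ^ 201 * (w ^ 798)⁻¹ := by gcongr
        _ ≤ 1 / 2 := by
          rw [mul_inv_le_iff₀ (by positivity)]
          have h1 : w ^ 202 ≤ w ^ 798 := hpw _ _ (by norm_num)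
          have h2 : w ^ 202 = w * w ^ 201 := by ring
          have h3 : 0 < w ^ 201 := by positivity
          nlinarith)
    rw [← hN] at this
    calc ((N.choose k : ℕ) : ℝ) / 2 ^ (k.choose 2) ≤ (2 * n.choose k) / 2 ^ (k.choose 2) := by gcongr
      _ = 2 * ((n.choose k : ℝ) / 2 ^ (k.choose 2)) := by ring
      _ ≤ _ := by gcongr
  have hNw : (N:ℝ) ≤ 2 * w ^ 800 := by
    rw [hN]; push_cast
    have h1 : w ^ 201 ≤ w ^ 800 := hpw _ _ (by norm_num)
    push_cast at hrk
    linarith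
  have hzall := choose_sub_le (N := N) (k := k) hz0 (by omega) hzN
  set m := k - k / 8 with hm
  have h2m : w ^ 1398 ≤ (2:ℝ) ^ m := by
    refine le_of_pow_le_pow_left₀ (n := 8) (by norm_num) (by positivity) ?_
    calc (w ^ 1398) ^ 8 = w ^ 11184 := by rw [← pow_mul]
      _ ≤ w ^ 11186 := hpw _ _ (by norm_num)
      _ = (w ^ 1598) ^ 7 := by rw [← pow_mul]
      _ ≤ ((2:ℝ) ^ k) ^ 7 := by gcongr
      _ = 2 ^ (k * 7) := by rw [pow_mul]
      _ ≤ 2 ^ (m * 8) := pow_le_pow_right₀ (by norm_num) (by omega)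
      _ = _ := by rw [pow_mul]
  set y : ℝ := (w ^ 596)⁻¹ with hydef
  have hy : ((k * N : ℕ) : ℝ) ≤ y * 2 ^ m := by
    push_cast
    calc (k:ℝ) * N ≤ w * (2 * w ^ 800) := by gcongr
      _ ≤ w * (w * w ^ 800) := by gcongr; linarith
      _ = (w ^ 596)⁻¹ * w ^ 1398 := by field_simp
      _ ≤ _ := by rw [hydef]; gcongr
  set γ : ℝ := (w ^ 1593)⁻¹ with hγdef
  have hmain := sum_bad (m := m) S hS hdisj U C y z γ (inv_le_one_of_one_le₀ (one_le_pow₀ hw1))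
    (by positivity) hy hz0 (by positivity) hzall
    (fun t ht2 htm => gamma_bound hw hk h2u (by omega) ht2 htm) hC
  refine hmain.trans ?_
  have hq : ((A + r : ℕ) : ℝ) ≤ w ^ 401 := by
    push_cast
    have h1 : w ^ 200 ≤ w ^ 400 := hpw _ _ (by norm_num)
    have h2 : w ^ 401 = w * w ^ 400 := by ring
    have h3 : 0 < w ^ 400 := by positivity
    nlinarith
  have hinv : ∀ a b : ℕ, a + 1 ≤ b → w ^ a * (w ^ b)⁻¹ ≤ 1 / w := by
    intro a b hab
    rw [mul_inv_le_iff₀ (by positivity), one_div_mul_eq_div, le_div_iff₀ hw0, ← pow_succ]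
    exact hpw _ _ hab
  have t1 : (U.card : ℝ) * N.choose (k - 1) / 2 ^ (k.choose 2) ≤ 1 / w := by
    rw [hU]
    have hk1 : 1 ≤ k := by
      by_contra h
      have : k = 0 := by omega
      rw [this, pow_zero] at h2l
      have := hpw 1 1598 (by norm_num)
      simp at this
      linarith
    have h1 := hzall 1 hk1
    rw [pow_one] at h1
    calc ((r * k : ℕ) : ℝ) * N.choose (k - 1) / 2 ^ (k.choose 2)
        ≤ w ^ 201 * (N.choose k * z) / 2 ^ (k.choose 2) := by gcongr
      _ = w ^ 201 * z * ((N.choose k : ℝ) / 2 ^ (k.choose 2)) := by ring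
      _ ≤ w ^ 201 * z * (2 * w ^ 400) := by gcongr
      _ ≤ w ^ 201 * z * (w * w ^ 400) := by gcongr; linarith
      _ = w ^ 602 * (w ^ 798)⁻¹ := by rw [hzdef]; ring
      _ ≤ 1 / w := hinv _ _ (by norm_num)
  have t3 : ((A + r : ℕ) : ℝ) * (k * y) ≤ 1 / w := by
    calc ((A + r : ℕ) : ℝ) * (k * y) ≤ w ^ 401 * (w * y) := by gcongr
      _ = w ^ 402 * (w ^ 596)⁻¹ := by rw [hydef]; ring
      _ ≤ 1 / w := hinv _ _ (by norm_num)
  have t2 : (N.choose k : ℝ) / 2 ^ (k.choose 2) * ((1 + k * γ) ^ (A + r) - 1) ≤ 1 / w := by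
    have hx : ((A + r : ℕ) : ℝ) * (k * γ) ≤ w ^ 402 * (w ^ 1593)⁻¹ := by
      calc ((A + r : ℕ) : ℝ) * (k * γ) ≤ w ^ 401 * (w * γ) := by gcongr
        _ = _ := by rw [hγdef]; ring
    have hx0 : 0 ≤ ((A + r : ℕ) : ℝ) * (k * γ) := by positivity
    have hx1 : ((A + r : ℕ) : ℝ) * (k * γ) ≤ 1 := by
      refine hx.trans ((hinv _ _ (by norm_num)).trans ?_)
      rw [div_le_one hw0]; exact hw1
    have hpow : (1 + k * γ) ^ (A + r) - 1 ≤ 2 * (((A + r : ℕ) : ℝ) * (k * γ)) := by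
      have h1 : (1 + k * γ) ^ (A + r) ≤ Real.exp (((A + r : ℕ) : ℝ) * (k * γ)) := by
        rw [Real.exp_nat_mul]
        apply pow_le_pow_left₀ (by positivity)
        rw [add_comm]; exact Real.add_one_le_exp _
      have h2 := Real.abs_exp_sub_one_le (x := ((A + r : ℕ) : ℝ) * (k * γ)) (by rwa [abs_of_nonneg hx0])
      rw [abs_of_nonneg hx0] at h2
      have h3 := (abs_le.1 h2).2
      linarith
    calc _ ≤ (2 * w ^ 400) * (2 * (((A + r : ℕ) : ℝ) * (k * γ))) := by
          apply mul_le_mul hCN hpow _ (by positivity)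
          have : (1:ℝ) ≤ (1 + k * γ) ^ (A + r) := one_le_pow₀ (by
            have : 0 ≤ (k:ℝ) * γ := by positivity
            linarith)
          linarith
      _ ≤ (2 * w ^ 400) * (2 * (w ^ 402 * (w ^ 1593)⁻¹)) := by gcongr
      _ = 4 * (w ^ 802 * (w ^ 1593)⁻¹) := by ring
      _ ≤ w * (w ^ 802 * (w ^ 1593)⁻¹) := by gcongr; linarith
      _ = w ^ 803 * (w ^ 1593)⁻¹ := by ring
      _ ≤ 1 / w := hinv _ _ (by norm_num)
  have : 3 / w = 1 / w + 1 / w + 1 / w := by ring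
  rw [this]
  linarith


/-! ### Part 6: asymptotics -/

lemma logb_exp_half : 0 ≤ Real.logb 2 (Real.exp 1 / 2) := by
  apply Real.logb_nonneg (by norm_num)
  have := Real.add_one_le_exp (1:ℝ)
  linarith

lemma asym (W : ℝ) : ∃ N : ℕ, ∀ n ≥ N, ∃ w : ℝ, W ≤ w ∧ 1 ≤ w ∧ w = (n:ℝ) ^ (1 / 800 : ℝ) ∧
    (n:ℝ) = w ^ 800 ∧ (aa n : ℝ) ≤ w ∧ (2:ℝ) ^ (aa n) ≤ w ^ 1600 ∧ w ^ 1598 ≤ (2:ℝ) ^ (aa n) := by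
  have hl2 : 0 < Real.log 2 := Real.log_pos (by norm_num)
  have e1 : ∀ᶠ n : ℕ in atTop, W ≤ (n:ℝ) ^ (1 / 800 : ℝ) :=
    ((tendsto_rpow_atTop (by norm_num : (0:ℝ) < 1 / 800)).comp
      tendsto_natCast_atTop_atTop).eventually_ge_atTop W
  have e2 : ∀ᶠ n : ℕ in atTop, Real.log n ≤ Real.log 2 / 2 * (n:ℝ) ^ (1 / 800 : ℝ) := by
    have h := (isLittleO_log_rpow_atTop (by norm_num : (0:ℝ) < 1 / 800)).bound
      (c := Real.log 2 / 2) (by positivity)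
    have h' := tendsto_natCast_atTop_atTop (R := ℝ) |>.eventually h
    filter_upwards [h'] with n hn
    refine (le_abs_self _).trans ?_
    rw [Real.norm_eq_abs, Real.norm_eq_abs, abs_of_nonneg (by positivity : 0 ≤ (n:ℝ) ^ (1 / 800 : ℝ))] at hn
    exact hn
  have tL : Tendsto (fun n : ℕ => Real.logb 2 n) atTop atTop :=
    (Real.tendsto_logb_atTop (by norm_num)).comp tendsto_natCast_atTop_atTop
  have tLL : Tendsto (fun n : ℕ => Real.logb 2 (Real.logb 2 n)) atTop atTop :=
    (Real.tendsto_logb_atTop (by norm_num)).comp tL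
  have e3 := tL.eventually_ge_atTop 1
  have e4 := tLL.eventually_ge_atTop (Real.logb 2 (Real.exp 1 / 2) + 1)
  obtain ⟨N, hN⟩ := eventually_atTop.1 (((e1.and e2).and (e3.and e4)).and (eventually_ge_atTop 1))
  refine ⟨N, fun n hn => ?_⟩
  obtain ⟨⟨⟨h1, h2⟩, h3, h4⟩, h5⟩ := hN n hn
  have hn1 : (1:ℝ) ≤ n := by exact_mod_cast h5
  have hn0 : (0:ℝ) < n := by linarith
  set w := (n:ℝ) ^ (1 / 800 : ℝ) with hw
  have hw1 : 1 ≤ w := Real.one_le_rpow hn1 (by norm_num)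
  have hnw : (n:ℝ) = w ^ 800 := by
    rw [hw, ← Real.rpow_natCast, ← Real.rpow_mul hn0.le]
    norm_num
  set L := Real.logb 2 n with hL
  have hLw : L ≤ w / 2 := by
    rw [hL, Real.logb, div_le_iff₀ hl2]
    linarith
  have h2L : (2:ℝ) ^ L = n := Real.rpow_logb (by norm_num) (by norm_num) hn0
  have hc := logb_exp_half
  have hL0 : 0 < L := by linarith
  have h2LL : (2:ℝ) ^ (Real.logb 2 L) = L := Real.rpow_logb (by norm_num) (by norm_num) hL0
  have ha : alpha0 n ≤ 2 * L := by
    unfold alpha0; rw [← hL]; linarith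
  have hb : 2 * L - 2 * Real.logb 2 L ≤ alpha0 n - 1 := by
    unfold alpha0; rw [← hL]; linarith
  have hk1 : (aa n : ℝ) ≤ 2 * L := by
    unfold aa
    by_cases h : 0 ≤ alpha0 n
    · exact (Nat.floor_le h).trans ha
    · rw [Nat.floor_of_nonpos (by linarith)]; simp; linarith
  have hk2 : 2 * L - 2 * Real.logb 2 L ≤ aa n := by
    have := Nat.lt_floor_add_one (alpha0 n)
    unfold aa
    linarith
  refine ⟨w, h1, hw1, rfl, hnw, by linarith, ?_, ?_⟩
  · calc (2:ℝ) ^ (aa n) = (2:ℝ) ^ ((aa n : ℕ) : ℝ) := (Real.rpow_natCast _ _).symm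
      _ ≤ (2:ℝ) ^ (2 * L) := Real.rpow_le_rpow_of_exponent_le (by norm_num) hk1
      _ = ((2:ℝ) ^ L) ^ 2 := by
        rw [mul_comm, Real.rpow_mul (by norm_num)]; norm_cast
      _ = w ^ 1600 := by rw [h2L, hnw, ← pow_mul]
  · calc w ^ 1598 = w ^ 1600 / w ^ 2 := by
          rw [eq_div_iff (by positivity), ← pow_add]
      _ ≤ w ^ 1600 / L ^ 2 := by
          gcongr; linarith
      _ = ((2:ℝ) ^ L) ^ 2 / ((2:ℝ) ^ (Real.logb 2 L)) ^ 2 := by rw [h2L, h2LL, hnw, ← pow_mul]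
      _ = (2:ℝ) ^ (2 * L - 2 * Real.logb 2 L) := by
          rw [Real.rpow_sub (by norm_num), mul_comm, Real.rpow_mul (by norm_num),
            mul_comm 2 (Real.logb 2 L), Real.rpow_mul (by norm_num)]
          norm_cast
      _ ≤ (2:ℝ) ^ ((aa n : ℕ) : ℝ) := Real.rpow_le_rpow_of_exponent_le (by norm_num) hk2
      _ = (2:ℝ) ^ (aa n) := Real.rpow_natCast _ _

lemma mu_bound {n : ℕ} {w ε : ℝ} (hε : 0 < ε) (hw1 : 1 ≤ w) (hw : w = (n:ℝ) ^ (1 / 800 : ℝ))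
    (hn : (n:ℝ) = w ^ 800) (h1 : ε < xx n) (h2 : xx n < 1 / 2 - ε) :
    mu n ≤ w ^ 400 ∧ ((⌊(n : ℝ) ^ (xx n / 2)⌋₊ : ℕ) : ℝ) ≤ w ^ 200 := by
  have hn1 : (1:ℝ) ≤ n := by rw [hn]; exact one_le_pow₀ hw1
  have hn0 : (0:ℝ) < n := by linarith
  have hpw : ∀ j : ℕ, w ^ j = (n:ℝ) ^ ((1 / 800 : ℝ) * j) := by
    intro j
    rw [hw, Real.rpow_mul hn0.le, Real.rpow_natCast]
  have hmu0 : 0 ≤ mu n := by unfold mu; positivity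
  have hmu : mu n = (n:ℝ) ^ xx n := by
    have hmne : mu n ≠ 0 := by
      intro h
      rw [xx, h] at h1
      simp at h1
      linarith
    have hlog : Real.log n ≠ 0 := by
      intro h
      rw [xx, h] at h1
      simp at h1
      linarith
    rw [Real.rpow_def_of_pos hn0, xx, mul_div_cancel₀ _ hlog, Real.exp_log (lt_of_le_of_ne hmu0 hmne.symm)]
  constructor
  · rw [hmu, hpw]
    apply Real.rpow_le_rpow_of_exponent_le hn1
    push_cast; linarith
  · refine (Nat.floor_le (by positivity)).trans ?_
    rw [hpw]
    apply Real.rpow_le_rpow_of_exponent_le hn1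
    push_cast; linarith

/-- Claim 2: `H′ ∼ G(n′,1/2)` conditioned on the independent `a(n)`-sets being exactly
the fixed pairwise disjoint sets `S₁, …, S_{A+r}`, and `H` is the induced subgraph of
`H′` on `V = V′ ∖ (S₁ ∪ … ∪ S_r)`, regarded as a graph on `{1,…,n}` via the
order-preserving bijection `{1,…,n} ≃ V`. For every vertex-relabelling-invariant event
`B`, `P(H ∈ B) ≤ (1+δ) P(G(n,1/2) ∈ B ∣ {X_a = A} ∩ E)`. (Both conditioned
distributions are uniform on their supports, so probabilities are ratios of counts.) -/
theorem stmt12 (ε : ℝ) (hε : 0 < ε) (hε4 : ε < 1/4) :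
    ∀ δ > (0:ℝ), ∃ N : ℕ, ∀ n ≥ N, ε < xx n → xx n < 1/2 - ε →
    ∀ A : ℕ, mu n / 2 ≤ (A : ℝ) → (A : ℝ) ≤ 2 * mu n →
    ∀ r n' : ℕ, r = ⌊(n : ℝ) ^ (xx n / 2)⌋₊ → n' = n + r * aa n →
    ∀ S : Fin (A + r) → Finset (Fin n'),
      (∀ i, (S i).card = aa n) → Pairwise (Function.onFun Disjoint S) →
    ∀ V : Finset (Fin n'),
      V = Finset.univ \ (Finset.univ.filter (fun i : Fin (A + r) => (i : ℕ) < r)).biUnion S →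
    ∀ hV : V.card = n,
    ∀ B : SimpleGraph (Fin n) → Prop,
      (∀ (π : Equiv.Perm (Fin n)) (G : SimpleGraph (Fin n)),
        B G ↔ B (G.map π.toEmbedding)) →
      -- P(H ∈ B)
      (Nat.card {H' : SimpleGraph (Fin n') // ExactIndepSets (aa n) S H' ∧
          B (SimpleGraph.comap (fun i : Fin n => ((V.orderIsoOfFin hV i : Fin n'))) H')} : ℝ) /
        (Nat.card {H' : SimpleGraph (Fin n') // ExactIndepSets (aa n) S H'} : ℝ)
      ≤ (1 + δ) *
        -- P(G(n,1/2) ∈ B | {X_a = A} ∩ E)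
        ((Nat.card {G : SimpleGraph (Fin n) //
            (numIndep n (aa n) G = A ∧ AllDisjoint n (aa n) G) ∧ B G} : ℝ) /
          (Nat.card {G : SimpleGraph (Fin n) //
            numIndep n (aa n) G = A ∧ AllDisjoint n (aa n) G} : ℝ)) := by
  intro δ hδ
  obtain ⟨N0, hN0⟩ := asym (max (2 ^ 136) (3 * (1 + δ) / δ))
  refine ⟨N0, ?_⟩
  intro n hn hx1 hx2 A hA1 hA2 r n' hr hn' S hS hdisj V hVdef hV B hB
  obtain ⟨w, hW, hw1, hwdef, hnw, hkw, h2u, h2l⟩ := hN0 n hn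
  obtain ⟨hmu, hrw⟩ := mu_bound hε hw1 hwdef hnw hx1 hx2
  rw [← hr] at hrw
  have hw136 : 2 ^ 136 ≤ w := (le_max_left _ _).trans hW
  have hwδ : 3 * (1 + δ) / δ ≤ w := (le_max_right _ _).trans hW
  have hw0 : 0 < w := by linarith
  have hkpos : 0 < aa n := by
    rcases Nat.eq_zero_or_pos (aa n) with h | h
    · exfalso
      rw [h, pow_zero] at h2l
      have : w ^ 1 ≤ w ^ 1598 := pow_le_pow_right₀ hw1 (by norm_num)
      have h3 : (2:ℝ) ≤ 2 ^ 136 := by norm_num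
      rw [pow_one] at this
      linarith
    · exact h
  have hmemV : ∀ v, v ∈ V ↔ ∀ i : Fin (A + r), (i : ℕ) < r → v ∉ S i := by
    intro v
    rw [hVdef]
    simp
  have hVin : ∀ i : Fin (A + r), r ≤ (i:ℕ) → S i ⊆ V := by
    intro i hi v hv
    rw [hmemV]
    intro j hj hvj
    have hij : i ≠ j := by
      rintro rfl
      omega
    exact Finset.disjoint_left.1 (hdisj hij) hv hvj
  have hVout : ∀ i : Fin (A + r), (i:ℕ) < r → Disjoint (S i) V := by
    intro i hi
    rw [Finset.disjoint_left]
    intro v hv hvV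
    exact (hmemV v).1 hvV i hi hv
  let e : Fin n ↪ Fin n' := ⟨fun i => ((V.orderIsoOfFin hV i : Fin n')), fun i j h =>
    (V.orderIsoOfFin hV).injective (Subtype.ext h)⟩
  have he : ∀ v, v ∈ V ↔ ∃ i, e i = v := by
    intro v
    constructor
    · intro hv
      refine ⟨(V.orderIsoOfFin hV).symm ⟨v, hv⟩, ?_⟩
      show ((V.orderIsoOfFin hV ((V.orderIsoOfFin hV).symm ⟨v, hv⟩) : V) : Fin n') = v
      rw [OrderIso.apply_symm_apply]
    · rintro ⟨i, rfl⟩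
      exact (V.orderIsoOfFin hV i).2
  classical
  have hU : (Finset.univ \ V).card = r * aa n := by
    have := Finset.card_sdiff_add_card_eq_card (Finset.subset_univ V)
    rw [Finset.card_univ, Fintype.card_fin, hV] at this
    omega
  have hδw : 3 / w * (1 + δ) ≤ δ := by
    rw [div_mul_eq_mul_div, div_le_iff₀ hw0]
    rw [div_le_iff₀ hδ] at hwδ
    linarith
  have hE1 : 3 / w < 1 := by
    rw [div_lt_one hw0]
    have h3 : (3:ℝ) < 2 ^ 136 := by norm_num
    linarith
  refine main_comb hkpos S hS hdisj V hVin hVout e he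
    (Finset.univ.filter (fun T : Finset (Fin n') => T.card = aa n ∧ (∀ i, T ≠ S i) ∧ ¬ T ⊆ V))
    (fun T => by simp) (3 / w) δ ?_ hE1 (by linarith) B hB
  refine numeric hn' hw136 hnw hkw h2u h2l ?_ hrw ?_ S hS hdisj (Finset.univ \ V) hU _ ?_
  · rw [div_eq_mul_inv, ← inv_pow]
    exact hmu
  · linarith
  · intro T hT
    obtain ⟨h1, h2, h3⟩ := (Finset.mem_filter.1 hT).2
    refine ⟨h1, h2, ?_⟩
    obtain ⟨v, hv, hv'⟩ := Finset.not_subset.1 h3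
    exact ⟨v, hv, by simp [hv']⟩
end

section
/- Fix ε ∈ (0, 1/4), and let s, t : ℕ → ℝ be sequences such that P(χ(G(n,1/2)) ∈ [s_n, t_n]) → 1 as n → ∞ and such that |s_n − f(n)| = o(n/(log n)²) (i.e., (s_n − f(n))·(log n)²/n → 0). Then there is N = N_ε such that for all n ≥ N with n^ε ≤ μ(n) ≤ n^{1/2 − ε}: setting r = ⌊n^{x(n)/2}⌋ and n′ = n + r·a(n), one has t_n − s_n ≥ s_{n′} − s_n − r. -/
open Filter

/-- The chromatic number of a graph on `Fin n`, as a natural number. -/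
noncomputable def chi (n : ℕ) (G : SimpleGraph (Fin n)) : ℕ := G.chromaticNumber.toNat

/-- Probability of an event under `G(n,1/2)`, i.e. the uniform measure on all
simple graphs on `{1,…,n}` (each edge present independently with probability 1/2). -/
noncomputable def Pr (n : ℕ) (B : SimpleGraph (Fin n) → Prop) : ℝ :=
  (Nat.card {G : SimpleGraph (Fin n) // B G} : ℝ) / (Nat.card (SimpleGraph (Fin n)) : ℝ)

/-- `f(n) = n / (2 log₂ n − 2 log₂ log₂ n − 2)`. -/
noncomputable def f (n : ℕ) : ℝ :=
  n / (2 * Real.logb 2 n - 2 * Real.logb 2 (Real.logb 2 n) - 2)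

lemma le_of_sq_le_sq' {a b : ℝ} (hb : 0 ≤ b) (h : a ^ 2 ≤ b ^ 2) : a ≤ b := _root_.le_of_sq_le_sq h hb

def ind {V : Type} (S : Finset V) (G : SimpleGraph V) : Prop :=
  ∀ u ∈ S, ∀ v ∈ S, ¬ G.Adj u v

section
open Classical

lemma fiber_card {V : Type} [Fintype V] (S : Finset V) (H : SimpleGraph {v // v ∉ S}) :
    (Finset.univ.filter (fun G : SimpleGraph V => ind S G ∧ G.comap Subtype.val = H)).card
    = (Finset.univ.filter (fun G : SimpleGraph V => ind S G ∧
        G.comap (Subtype.val : {v // v ∉ S} → V) = ⊥)).card := by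
  have key : ∀ G : SimpleGraph V, ∀ H : SimpleGraph {v // v ∉ S},
      ind S G → ind S (symmDiff G (H.map (Function.Embedding.subtype _))) := by
    intro G H hG u hu v hv
    have := hG u hu v hv
    simp only [symmDiff, SimpleGraph.sup_adj, SimpleGraph.sdiff_adj, this, SimpleGraph.map_adj]
    rintro (h | h)
    · exact h.1
    · obtain ⟨⟨x, y, h1, h2, h3⟩, _⟩ := h
      exact x.2 (by simpa [← h2] using hu)
  have key2 : ∀ G : SimpleGraph V, ∀ H : SimpleGraph {v // v ∉ S},
      (symmDiff G (H.map (Function.Embedding.subtype _))).comap (Subtype.val : {v // v ∉ S} → V)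
       = symmDiff (G.comap Subtype.val) H := by
    intro G H
    ext u v
    have : (H.map (Function.Embedding.subtype _)).Adj (u : V) (v : V) ↔ H.Adj u v :=
      SimpleGraph.map_adj_apply (f := Function.Embedding.subtype _)
    simp only [symmDiff, SimpleGraph.sup_adj, SimpleGraph.sdiff_adj, SimpleGraph.comap_adj, this]
  apply Finset.card_nbij' (fun G => symmDiff G (H.map (Function.Embedding.subtype _)))
    (fun G => symmDiff G (H.map (Function.Embedding.subtype _)))
  · intro G hG
    simp only [Finset.coe_filter, Finset.mem_univ, true_and, Set.mem_ofPred_eq] at hG ⊢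
    exact ⟨key _ _ hG.1, by rw [key2, hG.2, symmDiff_self]⟩
  · intro G hG
    simp only [Finset.coe_filter, Finset.mem_univ, true_and, Set.mem_ofPred_eq] at hG ⊢
    exact ⟨key _ _ hG.1, by rw [key2, hG.2, bot_symmDiff]⟩
  · intro G _; exact symmDiff_symmDiff_cancel_right _ _
  · intro G _; exact symmDiff_symmDiff_cancel_right _ _

lemma factor_aux {V : Type} [Fintype V] (S : Finset V) (B : SimpleGraph {v // v ∉ S} → Prop) :
    (Finset.univ.filter (fun G : SimpleGraph V => ind S G ∧ B (G.comap Subtype.val))).card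
    = (Finset.univ.filter B).card * (Finset.univ.filter (fun G : SimpleGraph V => ind S G ∧
        G.comap (Subtype.val : {v // v ∉ S} → V) = ⊥)).card := by
  rw [Finset.card_eq_sum_card_fiberwise (f := fun G => G.comap Subtype.val)
    (t := Finset.univ.filter B) (by intro G hG; simp at hG ⊢; exact hG.2)]
  rw [Finset.sum_const_nat]
  intro H hH
  rw [← fiber_card S H, Finset.filter_filter]
  congr 1
  ext G
  simp only [Finset.mem_filter, Finset.mem_univ, true_and] at hH ⊢
  constructor
  · rintro ⟨⟨h1, h2⟩, h3⟩; exact ⟨h1, h3⟩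
  · rintro ⟨h1, h3⟩; exact ⟨⟨h1, h3 ▸ hH⟩, h3⟩

lemma factor {V : Type} [Fintype V] (S : Finset V) (B : SimpleGraph {v // v ∉ S} → Prop) :
    (Finset.univ.filter (fun G : SimpleGraph V => ind S G ∧ B (G.comap Subtype.val))).card
      * Fintype.card (SimpleGraph {v // v ∉ S})
    = (Finset.univ.filter (fun G : SimpleGraph V => ind S G)).card
      * (Finset.univ.filter B).card := by
  have h1 := factor_aux S B
  have h2 := factor_aux S (fun _ => True)
  simp only [and_true] at h2
  rw [h1, h2]
  simp
  ring

lemma card_avoid {V : Type} [Fintype V] (D : Finset (Sym2 V))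
    (hD : D ⊆ (⊤ : SimpleGraph V).edgeFinset) :
    (Finset.univ.filter (fun G : SimpleGraph V => ∀ e ∈ D, e ∉ G.edgeSet)).card * 2 ^ D.card
      = Fintype.card (SimpleGraph V) := by
  have key : ∀ D : Finset (Sym2 V),
    (Finset.univ.filter (fun G : SimpleGraph V => ∀ e ∈ D, e ∉ G.edgeSet)).card
      = 2 ^ ((⊤ : SimpleGraph V).edgeFinset \ D).card := by
    intro D
    rw [← Finset.card_powerset]
    apply Finset.card_nbij' (fun G : SimpleGraph V => Finset.univ.filter (fun e : Sym2 V => e ∈ G.edgeSet))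
      (fun s : Finset (Sym2 V) => SimpleGraph.fromEdgeSet (s : Set (Sym2 V)))
    · intro G hG
      simp only [Finset.coe_filter, Finset.mem_univ, true_and, Set.mem_ofPred_eq] at hG
      simp only [Finset.mem_coe, Finset.mem_powerset]
      intro e he
      rw [Finset.mem_sdiff]
      have he : e ∈ G.edgeSet := by simpa using he
      exact ⟨by rw [SimpleGraph.mem_edgeFinset]; exact SimpleGraph.edgeSet_mono le_top he,
        fun h => hG e h he⟩
    · intro s hs
      simp only [Finset.coe_filter, Finset.mem_univ, true_and, Set.mem_ofPred_eq]
      simp only [Finset.mem_coe, Finset.mem_powerset] at hs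
      intro e he h
      rw [SimpleGraph.edgeSet_fromEdgeSet] at h
      exact (Finset.mem_sdiff.1 (hs h.1)).2 he
    · intro G _
      simp
    · intro s hs
      simp only [Finset.mem_coe, Finset.mem_powerset] at hs
      ext e
      simp only [Finset.mem_filter, SimpleGraph.edgeSet_fromEdgeSet, Finset.mem_univ, true_and]
      constructor
      · intro h; exact h.1
      · intro h
        refine ⟨h, ?_⟩
        have := (Finset.mem_sdiff.1 (hs h)).1
        simpa using this
  have h0 := key ∅
  simp only [Finset.notMem_empty, false_imp_iff, imp_true_iff, Finset.filter_true, Finset.sdiff_empty, Finset.card_univ] at h0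
  rw [key, h0, ← pow_add, Finset.card_sdiff_add_card_eq_card hD]

noncomputable def DD {V : Type} (S : Finset V) : Finset (Sym2 V) := S.offDiag.image (Function.uncurry Sym2.mk)

lemma mem_DD {V : Type} (S : Finset V) (u v : V) : s(u,v) ∈ DD S ↔ u ∈ S ∧ v ∈ S ∧ u ≠ v := by
  simp only [DD, Finset.mem_image, Finset.mem_offDiag, Prod.exists]
  constructor
  · rintro ⟨x, y, h, h2⟩
    rcases Sym2.eq_iff.1 h2 with ⟨rfl, rfl⟩ | ⟨rfl, rfl⟩
    · exact h
    · exact ⟨h.2.1, h.1, h.2.2.symm⟩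
  · intro h; exact ⟨u, v, h, rfl⟩

lemma card_DD {V : Type} (S : Finset V) : (DD S).card = S.card.choose 2 :=
  Sym2.card_image_offDiag S

lemma DD_sub {V : Type} [Fintype V] (S : Finset V) : DD S ⊆ (⊤ : SimpleGraph V).edgeFinset := by
  intro e
  induction e using Sym2.ind with
  | _ u v => rw [mem_DD]; simp

lemma DD_inter {V : Type} (S T : Finset V) : DD S ∩ DD T = DD (S ∩ T) := by
  ext e
  induction e using Sym2.ind with
  | _ u v => simp only [Finset.mem_inter, mem_DD]; tauto

lemma ind_iff {V : Type} (S : Finset V) (G : SimpleGraph V) :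
    ind S G ↔ ∀ e ∈ DD S, e ∉ G.edgeSet := by
  constructor
  · intro h e
    induction e using Sym2.ind with
    | _ u v => rw [mem_DD, SimpleGraph.mem_edgeSet]; intro h2; exact h u h2.1 v h2.2.1
  · intro h u hu v hv huv
    exact h s(u,v) ((mem_DD _ _ _).2 ⟨hu, hv, huv.ne⟩) huv

lemma card_ind {V : Type} [Fintype V] (S : Finset V) :
    (Finset.univ.filter (fun G : SimpleGraph V => ind S G)).card * 2 ^ (S.card.choose 2)
      = Fintype.card (SimpleGraph V) := by
  rw [← card_avoid (DD S) (DD_sub S), card_DD]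
  simp only [ind_iff]

lemma card_ind2 {V : Type} [Fintype V] (S T : Finset V) :
    (Finset.univ.filter (fun G : SimpleGraph V => ind S G ∧ ind T G)).card
      * (2 ^ (S.card.choose 2) * 2 ^ (T.card.choose 2))
      = Fintype.card (SimpleGraph V) * 2 ^ ((S ∩ T).card.choose 2) := by
  rw [← card_avoid (DD S ∪ DD T) (Finset.union_subset (DD_sub S) (DD_sub T))]
  have : (DD S ∪ DD T).card + (DD (S ∩ T)).card = (DD S).card + (DD T).card := by
    rw [← DD_inter]; exact Finset.card_union_add_card_inter _ _
  rw [card_DD, card_DD, card_DD] at this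
  rw [mul_assoc, ← pow_add, ← pow_add, this]
  simp only [ind_iff, Finset.mem_union, or_imp, forall_and]

lemma chi_le_iff (n : ℕ) (G : SimpleGraph (Fin n)) (k : ℕ) : chi n G ≤ k ↔ G.Colorable k := by
  rw [← SimpleGraph.chromaticNumber_le_iff_colorable, chi]
  have : G.chromaticNumber ≠ ⊤ := by
    rw [SimpleGraph.chromaticNumber_ne_top_iff_exists]
    exact ⟨_, G.colorable_of_fintype⟩
  lift G.chromaticNumber to ℕ using this with c hc
  simp

lemma col_step {V : Type} [Fintype V] (S : Finset V) (G : SimpleGraph V) (h : ind S G) (k : ℕ)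
    (hc : (G.comap (Subtype.val : {v // v ∉ S} → V)).Colorable k) : G.Colorable (k+1) := by
  obtain ⟨c⟩ := hc
  have : Nonempty (G.Coloring (Option (Fin k))) := by
    refine ⟨SimpleGraph.Coloring.mk (fun v => if hv : v ∈ S then none else some (c ⟨v, hv⟩)) ?_⟩
    intro u v huv
    by_cases hu : u ∈ S <;> by_cases hv : v ∈ S
    · exact absurd huv (h u hu v hv)
    · simp [hu, hv]
    · simp [hu, hv]
    · simp only [hu, hv, dif_neg, not_false_eq_true, ne_eq, Option.some.injEq]
      exact c.valid (v := ⟨u, hu⟩) (w := ⟨v, hv⟩) huv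
  obtain ⟨c'⟩ := this
  have := c'.colorable
  simpa using this

def Ev {V : Type} (y : ℝ) (G : SimpleGraph V) : Prop := ∀ k : ℕ, G.Colorable k → y ≤ k

noncomputable def q (V : Type) (y : ℝ) : ℝ :=
  (Nat.card {G : SimpleGraph V // Ev y G} : ℝ) / (Nat.card (SimpleGraph V) : ℝ)

lemma Pr_eq_q (n : ℕ) (y : ℝ) : Pr n (fun G => y ≤ chi n G) = q (Fin n) y := by
  rw [Pr, q]
  have : ∀ G : SimpleGraph (Fin n), y ≤ chi n G ↔ Ev y G := by
    intro G
    constructor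
    · intro h k hk
      have := (chi_le_iff n G k).2 hk
      have : (chi n G : ℝ) ≤ k := by exact_mod_cast this
      linarith
    · intro h; exact h _ ((chi_le_iff n G _).1 le_rfl)
  simp only [this]

lemma q_eq (V : Type) (y : ℝ) [Fintype (SimpleGraph V)] [DecidablePred (fun G : SimpleGraph V => Ev y G)] :
    q V y = ((Finset.univ.filter (fun G : SimpleGraph V => Ev y G)).card : ℝ)
      / Fintype.card (SimpleGraph V) := by
  rw [q, Nat.card_eq_fintype_card, Nat.card_eq_fintype_card, Fintype.card_subtype]

lemma q_congr {V W : Type} (e : V ≃ W) (y : ℝ) : q V y = q W y := by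
  have hc : ∀ G : SimpleGraph V, ∀ k, (e.simpleGraph G).Colorable k ↔ G.Colorable k := by
    intro G k
    have i : e.simpleGraph G ≃g G := by
      refine ⟨e.symm, ?_⟩
      intro a b
      simp [Equiv.simpleGraph]
    exact ⟨fun h => h.of_hom i.symm.toHom, fun h => h.of_hom i.toHom⟩
  rw [q, q, Nat.card_congr e.simpleGraph]
  congr 2
  apply Nat.card_congr
  apply Equiv.subtypeEquiv e.simpleGraph
  intro G
  simp only [Ev, hc]


lemma transfer_aux {V : Type} [Fintype V] (S : Finset V) (y : ℝ) :
    (Finset.univ.filter (fun G : SimpleGraph V => Ev (y + 1) G ∧ ind S G)).card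
    ≤ (Finset.univ.filter (fun G : SimpleGraph V => ind S G ∧ Ev y (G.comap (Subtype.val : {v // v ∉ S} → V)))).card := by
  apply Finset.card_le_card
  apply Finset.monotone_filter_right
  rintro G - ⟨hy, hi⟩
  refine ⟨hi, ?_⟩
  intro k hk
  have := hy _ (col_step S G hi k hk)
  push_cast at this
  linarith

lemma arith_aux {a b c d e : ℕ} (h : b * c = d * e) (hab : a ≤ b) (hc : 0 < c) :
    (a : ℝ) ≤ d * ((e : ℝ) / c) := by
  have hpos : (0:ℝ) < c := by exact_mod_cast hc
  rw [← mul_div_assoc, le_div_iff₀ hpos]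
  norm_cast
  rw [← h]
  exact Nat.mul_le_mul_right _ hab

lemma transfer {V : Type} [Fintype V] (S : Finset V) (y : ℝ) :
    ((Finset.univ.filter (fun G : SimpleGraph V => Ev (y + 1) G ∧ ind S G)).card : ℝ)
    ≤ (Finset.univ.filter (fun G : SimpleGraph V => ind S G)).card *
      q {v // v ∉ S} y := by
  rw [q_eq]
  exact arith_aux (factor S (fun G => Ev y G)) (transfer_aux S y) Fintype.card_pos

lemma count_sup {V : Type} [Fintype V] (a : ℕ) (L : Finset V) (hL : L.card ≤ a) :
    ((Finset.powersetCard a Finset.univ).filter (fun T : Finset V => L ⊆ T)).card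
      = (Fintype.card V - L.card).choose (a - L.card) := by
  rw [← Finset.card_compl, ← Finset.card_powersetCard]
  apply Finset.card_nbij' (fun T => T \ L) (fun T => T ∪ L)
  · intro T hT
    simp only [Finset.coe_filter, Finset.mem_powersetCard, Set.mem_ofPred_eq, Finset.mem_coe] at hT ⊢
    refine ⟨?_, ?_⟩
    · intro x hx; simp at hx ⊢; exact hx.2
    · rw [Finset.card_sdiff_of_subset hT.2, hT.1.2]
  · intro T hT
    simp only [Finset.coe_filter, Finset.mem_powersetCard, Set.mem_ofPred_eq, Finset.mem_coe] at hT ⊢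
    refine ⟨⟨Finset.subset_univ _, ?_⟩, Finset.subset_union_right⟩
    rw [Finset.card_union_of_disjoint, hT.2]
    · omega
    · rw [Finset.disjoint_left]; intro x hx; simpa using hT.1 hx
  · intro T hT
    simp only [Finset.coe_filter, Finset.mem_powersetCard, Set.mem_ofPred_eq] at hT
    exact Finset.sdiff_union_of_subset hT.2
  · intro T hT
    simp only [Finset.mem_powersetCard, Finset.mem_coe] at hT
    apply Finset.union_sdiff_cancel_right
    rw [Finset.disjoint_left]; intro x hx; simpa using hT.1 hx

noncomputable def del (n a : ℕ) : ℝ :=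
  ∑ k ∈ Finset.Icc 2 a, (a.choose k : ℝ) ^ 2 * 2 ^ (k.choose 2) / (n.choose k)

lemma overlap {V : Type} [Fintype V] (a : ℕ) (ha : a ≤ Fintype.card V) (S : Finset V) (hS : S.card = a) :
    ∑ T ∈ Finset.powersetCard a (Finset.univ : Finset V),
      ((2:ℝ) ^ ((S ∩ T).card.choose 2) - 1) ≤ (Fintype.card V).choose a * del (Fintype.card V) a := by
  set M := Fintype.card V with hM
  calc _ ≤ ∑ T ∈ Finset.powersetCard a (Finset.univ : Finset V),
        ∑ L ∈ S.powerset, if L ⊆ T ∧ 2 ≤ L.card then (2:ℝ) ^ (L.card.choose 2) else 0 := by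
        apply Finset.sum_le_sum
        intro T hT
        have hnn : ∀ L ∈ S.powerset, (0:ℝ) ≤ if L ⊆ T ∧ 2 ≤ L.card then (2:ℝ) ^ (L.card.choose 2) else 0 := by
          intro L _; split_ifs <;> positivity
        by_cases h2 : 2 ≤ (S ∩ T).card
        · have := Finset.single_le_sum hnn (Finset.mem_powerset.2 (Finset.inter_subset_left (s₁ := S) (s₂ := T)))
          rw [if_pos ⟨Finset.inter_subset_right, h2⟩] at this
          linarith
        · rw [Nat.choose_eq_zero_of_lt (by omega)]
          simpa using Finset.sum_nonneg hnn
    _ = ∑ L ∈ S.powerset, ∑ T ∈ Finset.powersetCard a (Finset.univ : Finset V),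
          if L ⊆ T ∧ 2 ≤ L.card then (2:ℝ) ^ (L.card.choose 2) else 0 := Finset.sum_comm
    _ = ∑ L ∈ S.powerset, if 2 ≤ L.card then
          (2:ℝ) ^ (L.card.choose 2) * ((M - L.card).choose (a - L.card)) else 0 := by
        apply Finset.sum_congr rfl
        intro L hL
        have hLa : L.card ≤ a := hS ▸ Finset.card_le_card (Finset.mem_powerset.1 hL)
        split_ifs with h
        · simp only [h, and_true]
          rw [← Finset.sum_filter, Finset.sum_const, count_sup a L hLa, nsmul_eq_mul, mul_comm]
        · simp [h]
    _ = ∑ k ∈ Finset.range (a+1), a.choose k • (if 2 ≤ k then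
          (2:ℝ) ^ (k.choose 2) * ((M - k).choose (a - k)) else 0) := by
        rw [Finset.sum_powerset_apply_card (fun k => if 2 ≤ k then
          (2:ℝ) ^ (k.choose 2) * ((M - k).choose (a - k)) else 0), hS]
    _ = ∑ k ∈ Finset.Icc 2 a, (a.choose k : ℝ) * (2 ^ (k.choose 2) * ((M - k).choose (a - k))) := by
        simp only [nsmul_eq_mul, mul_ite, mul_zero]
        rw [← Finset.sum_filter]
        apply Finset.sum_congr _ (fun _ _ => rfl)
        ext k; simp; omega
    _ = M.choose a * del M a := by
        rw [del, Finset.mul_sum]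
        apply Finset.sum_congr rfl
        intro k hk
        have hk := Finset.mem_Icc.1 hk
        have h1 : (M.choose k : ℝ) ≠ 0 := by
          exact_mod_cast (Nat.choose_pos (by omega)).ne'
        have h2 := congrArg (Nat.cast : ℕ → ℝ) (Nat.choose_mul (n := M) hk.2)
        push_cast at h2
        field_simp
        linear_combination -(a.choose k : ℝ) * h2

lemma step {V : Type} [Fintype V] (a m : ℕ) (hm : Fintype.card V = m + a) (y : ℝ) :
    q V (y + 1) ≤ q (Fin m) y + Real.sqrt (del (m + a) a) / 2 := by
  have ha : a ≤ Fintype.card V := by omega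
  set PS := Finset.powersetCard a (Finset.univ : Finset V) with hPS
  set T : ℝ := ((Fintype.card (SimpleGraph V) : ℕ) : ℝ) with hT
  have hTpos : 0 < T := by rw [hT]; exact_mod_cast Fintype.card_pos
  set N : ℝ := (((m + a).choose a : ℕ) : ℝ) with hN
  have hNpos : 0 < N := by rw [hN]; exact_mod_cast Nat.choose_pos (by omega)
  set P : ℝ := 2 ^ (a.choose 2) with hP
  have hPpos : 0 < P := by positivity
  have hPScard : (PS.card : ℝ) = N := by rw [hPS, Finset.card_powersetCard, Finset.card_univ, hm]
  have hPSm : ∀ S ∈ PS, S.card = a := fun S hS => (Finset.mem_powersetCard.1 hS).2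
  let I : Finset V → SimpleGraph V → ℝ := fun S G => if ind S G then 1 else 0
  let X : SimpleGraph V → ℝ := fun G => ∑ S ∈ PS, I S G
  let J : SimpleGraph V → ℝ := fun G => if Ev (y+1) G then 1 else 0
  have hI : ∀ S ∈ PS, ∑ G, I S G = T / P := by
    intro S hS
    have := congrArg (Nat.cast : ℕ → ℝ) (card_ind S)
    push_cast at this
    rw [hPSm S hS] at this
    simp only [I, Finset.sum_boole]
    rw [eq_div_iff hPpos.ne']
    exact this
  have hII : ∀ S ∈ PS, ∀ S' ∈ PS, ∑ G, I S G * I S' G = T / P ^ 2 * 2 ^ ((S ∩ S').card.choose 2) := by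
    intro S hS S' hS'
    have := congrArg (Nat.cast : ℕ → ℝ) (card_ind2 S S')
    push_cast at this
    rw [hPSm S hS, hPSm S' hS'] at this
    have h2 : ∀ G, I S G * I S' G = if ind S G ∧ ind S' G then 1 else 0 := by
      intro G; by_cases h : ind S G <;> by_cases h' : ind S' G <;> simp [I, h, h']
    simp only [h2, Finset.sum_boole]
    field_simp
    rw [← hT] at this
    rw [← this]; ring
  have hX : ∑ G, X G = N * (T / P) := by
    simp only [X]
    rw [Finset.sum_comm, Finset.sum_congr rfl hI, Finset.sum_const, nsmul_eq_mul, hPScard]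
  have hXX : ∑ G, X G ^ 2 = T / P ^ 2 * ∑ S ∈ PS, ∑ S' ∈ PS, (2:ℝ) ^ ((S ∩ S').card.choose 2) := by
    simp only [X, sq (∑ S ∈ PS, _), Finset.sum_mul_sum]
    rw [Finset.sum_comm, Finset.mul_sum]
    apply Finset.sum_congr rfl
    intro S hS
    rw [Finset.sum_comm, Finset.mul_sum]
    apply Finset.sum_congr rfl
    intro S' hS'
    exact hII S hS S' hS'
  have hov : ∑ S ∈ PS, ∑ S' ∈ PS, ((2:ℝ) ^ ((S ∩ S').card.choose 2) - 1) ≤ N * (N * del (m+a) a) := by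
    calc _ ≤ ∑ S ∈ PS, N * del (m+a) a := by
          apply Finset.sum_le_sum
          intro S hS
          have := overlap a ha S (hPSm S hS)
          rwa [hm] at this
      _ = _ := by rw [Finset.sum_const, nsmul_eq_mul, hPScard]
  simp only [Finset.sum_sub_distrib, Finset.sum_const, nsmul_eq_mul, mul_one, hPScard] at hov
  set c : ℝ := N / P with hc
  have hcpos : 0 < c := by positivity
  have hTc : (∑ G : SimpleGraph V, (1:ℝ)) = T := by simp [hT]
  have hvar : ∑ G, (X G - c) ^ 2 ≤ T * c ^ 2 * del (m+a) a := by
    have e1 : ∀ G, (X G - c) ^ 2 = X G ^ 2 - 2 * c * X G + c ^ 2 * 1 := by intro G; ring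
    simp only [e1]
    rw [Finset.sum_add_distrib, Finset.sum_sub_distrib, ← Finset.mul_sum, ← Finset.mul_sum, hX, hXX, hTc]
    have : 0 ≤ T / P ^ 2 := by positivity
    have := mul_le_mul_of_nonneg_left hov this
    have e2 : T * c ^ 2 * del (m+a) a = T / P ^ 2 * (N * (N * del (m+a) a)) := by
      rw [hc]; field_simp
    rw [e2]
    refine le_trans (le_of_eq ?_) this
    rw [hc]; field_simp; ring
  have hdel : 0 ≤ del (m+a) a := Finset.sum_nonneg (fun k _ => by positivity)
  have hCS := Finset.sum_mul_sq_le_sq_mul_sq Finset.univ (fun G => 1/2 - J G) (fun G => X G - c)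
  have hJ : ∑ G, (1/2 - J G) ^ 2 = T / 4 := by
    have : ∀ G, (1/2 - J G) ^ 2 = 1/4 * 1 := by
      intro G; by_cases h : Ev (y+1) G <;> simp [J, h] <;> norm_num
    simp only [this]
    rw [← Finset.mul_sum, hTc]; ring
  rw [hJ] at hCS
  have hb : ∑ G, (1/2 - J G) * (X G - c) ≤ T * c * Real.sqrt (del (m+a) a) / 2 := by
    apply le_of_sq_le_sq' (by positivity)
    refine hCS.trans ?_
    have : (T * c * Real.sqrt (del (m+a) a) / 2) ^ 2 = T / 4 * (T * c ^ 2 * del (m+a) a) := by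
      rw [div_pow, mul_pow, Real.sq_sqrt hdel]; ring
    rw [this]
    exact mul_le_mul_of_nonneg_left hvar (by positivity)
  have hq : q V (y+1) * T = ∑ G, J G := by
    rw [q_eq, ← hT, div_mul_cancel₀ _ hTpos.ne']
    simp only [J, Finset.sum_boole]
  have hJX : ∑ G, J G * X G ≤ c * T * q (Fin m) y := by
    simp only [X, Finset.mul_sum]
    rw [Finset.sum_comm]
    calc _ ≤ ∑ S ∈ PS, T / P * q (Fin m) y := by
          apply Finset.sum_le_sum
          intro S hS
          have h1 := transfer S y
          have hcard : Fintype.card {v // v ∉ S} = m := by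
            rw [Fintype.card_subtype_compl]; simp [hPSm S hS, hm]
          rw [q_congr (Fintype.equivFinOfCardEq hcard)] at h1
          have h2 := hI S hS
          simp only [I, Finset.sum_boole] at h2
          rw [h2] at h1
          refine le_trans (le_of_eq ?_) h1
          rw [← Finset.sum_boole]
          apply Finset.sum_congr rfl
          intro G _
          by_cases h : Ev (y+1) G <;> by_cases h' : ind S G <;> simp [I, J, h, h']
      _ = _ := by rw [Finset.sum_const, nsmul_eq_mul, hPScard, hc]; ring
  have hexp : ∑ G, (1/2 - J G) * (X G - c) = (1/2) * (N * (T / P)) - (1/2) * c * T - ∑ G, J G * X G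
      + c * (q V (y+1) * T) := by
    have e1 : ∀ G, (1/2 - J G) * (X G - c) = (1/2) * X G - (1/2) * c * 1 - J G * X G + c * J G := by
      intro G; ring
    simp only [e1]
    rw [Finset.sum_add_distrib, Finset.sum_sub_distrib, Finset.sum_sub_distrib, ← Finset.mul_sum,
      ← Finset.mul_sum, ← Finset.mul_sum, hX, hTc, hq]
  have e3 : N * (T / P) = c * T := by rw [hc]; ring
  rw [hexp, e3] at hb
  have hfin : (c * T) * q V (y+1) ≤ (c * T) * (q (Fin m) y + Real.sqrt (del (m + a) a) / 2) := by
    nlinarith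
  exact le_of_mul_le_mul_left hfin (by positivity)

lemma del_anti (a n M : ℕ) (ha : a ≤ n) (h : n ≤ M) : del M a ≤ del n a := by
  apply Finset.sum_le_sum
  intro k hk
  have hk := Finset.mem_Icc.1 hk
  apply div_le_div_of_nonneg_left (by positivity)
  · exact_mod_cast Nat.choose_pos (by omega)
  · exact_mod_cast Nat.choose_le_choose k h

lemma iter (a n : ℕ) (ha : a ≤ n) (r : ℕ) (y : ℝ) :
    q (Fin (n + r * a)) (y + r) ≤ q (Fin n) y + r * (Real.sqrt (del n a) / 2) := by
  induction r with
  | zero => simp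
  | succ r ih =>
    have e : n + (r+1) * a = (n + r * a) + a := by ring
    rw [e]
    have h1 := step (V := Fin (n + r * a + a)) a (n + r * a) (by simp) (y + r)
    have h2 := Real.sqrt_le_sqrt (del_anti a n (n + r * a + a) ha (by rw [add_assoc]; exact Nat.le_add_right _ _))
    push_cast
    rw [← add_assoc]
    linarith
end

lemma ch2 (m : ℕ) : (m+1).choose 2 * 2 = (m+1) * m := by
  induction m with
  | zero => simp
  | succ m ih =>
    rw [Nat.choose_succ_succ' (m+1) 1, Nat.choose_one_right, add_mul, ih]; ring

lemma small_case (n a k : ℕ) (w μ : ℝ) (hw : 0 < w) (hn : (n:ℝ) = w ^ 4) (ha7 : 4 * (a:ℝ)^7 ≤ w^2)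
    (hμ : μ ≤ w ^ 2) (hk2 : 2 ≤ k) (hka : k < a) (h2a : 2 * a ≤ n) (hsm : (2:ℝ)^(k-1) ≤ n) :
    μ * ((a.choose k : ℝ) ^ 2 * 2 ^ (k.choose 2) / (n.choose k)) ≤ 1 / a := by
  have ha0 : (0:ℝ) < a := by exact_mod_cast (by omega : 0 < a)
  have ha1 : (1:ℝ) ≤ a := by exact_mod_cast (by omega : 1 ≤ a)
  have h1 : (a.choose k : ℝ) ≤ (a:ℝ)^k := by exact_mod_cast Nat.choose_le_pow a k
  have h2 : (2:ℝ) ^ (k.choose 2) ≤ (w^2)^k := by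
    apply le_of_sq_le_sq' (by positivity)
    obtain ⟨m, rfl⟩ : ∃ m, k = m + 1 := ⟨k-1, by omega⟩
    have e1 : ((2:ℝ) ^ ((m+1).choose 2))^2 = (2^m)^(m+1) := by
      rw [← pow_mul, ch2, mul_comm, pow_mul]
    have e2 : ((w^2)^(m+1))^2 = (n:ℝ)^(m+1) := by rw [hn]; ring
    rw [e1, e2]
    simp only [Nat.add_sub_cancel] at hsm
    exact pow_le_pow_left₀ (by positivity) hsm _
  have h3 : (w^4/(2*a))^k ≤ (n.choose k : ℝ) := by
    refine le_trans ?_ (Nat.pow_le_choose k n)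
    rw [div_pow, ← hn]
    have hf : (k.factorial : ℝ) ≤ (a:ℝ)^k := by
      have : k.factorial ≤ k^k := Nat.factorial_le_pow k
      have h : k^k ≤ a^k := Nat.pow_le_pow_left hka.le k
      exact_mod_cast this.trans h
    rw [mul_pow, ← div_div, ← div_pow]
    have hf0 : (0:ℝ) < k.factorial := by exact_mod_cast Nat.factorial_pos k
    apply div_le_div₀ (by positivity) _ hf0 hf
    apply pow_le_pow_left₀ (by positivity)
    rw [Nat.cast_sub (by omega)]
    push_cast
    have : (2:ℝ) * a ≤ n := by exact_mod_cast h2a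
    have : (k:ℝ) ≤ a := by exact_mod_cast hka.le
    linarith
  have hb : (a.choose k : ℝ) ^ 2 * 2 ^ (k.choose 2) / (n.choose k) ≤ (2*(a:ℝ)^3/w^2)^2 := by
    calc _ ≤ ((a:ℝ)^k)^2 * (w^2)^k / (w^4/(2*a))^k := by
          apply div_le_div₀ (by positivity) _ (by positivity) h3
          apply mul_le_mul (pow_le_pow_left₀ (by positivity) h1 2) h2 (by positivity) (by positivity)
      _ = (2*(a:ℝ)^3/w^2)^k := by
          rw [← pow_mul, mul_comm k 2, pow_mul, ← mul_pow, ← div_pow]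
          congr 1
          field_simp
      _ ≤ _ := by
          apply pow_le_pow_of_le_one (by positivity) _ hk2
          rw [div_le_one (by positivity)]
          have : (a:ℝ)^3 ≤ (a:ℝ)^7 := pow_le_pow_right₀ ha1 (by norm_num)
          nlinarith [pow_pos ha0 7]
  calc _ ≤ w^2 * (2*(a:ℝ)^3/w^2)^2 := by
        apply mul_le_mul hμ hb (by positivity) (by positivity)
    _ = 4 * (a:ℝ)^7 / w^2 / a := by field_simp; norm_num
    _ ≤ 1 / a := by
        apply div_le_div_of_nonneg_right _ ha0.le
        rw [div_le_one (by positivity)]; exact ha7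

lemma large_case (n a k : ℕ) (w : ℝ) (hw : 0 < w) (hn : (n:ℝ) = w ^ 4) (ha7 : 4 * (a:ℝ)^7 ≤ w^2)
    (h2w : w ^ 6 ≤ 2 ^ a) (hk2 : 2 ≤ k) (hka : k < a) (h2a : 2 * a ≤ n) (hsm : (n:ℝ) ≤ (2:ℝ)^(k-1)) :
    ((n.choose a : ℝ) * 2⁻¹ ^ (a.choose 2)) * ((a.choose k : ℝ) ^ 2 * 2 ^ (k.choose 2) / (n.choose k)) ≤ 1 / a := by
  have ha0 : (0:ℝ) < a := by exact_mod_cast (by omega : 0 < a)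
  have ha1 : (1:ℝ) ≤ a := by exact_mod_cast (by omega : 1 ≤ a)
  have haw : (a:ℝ)^2 ≤ w := by
    apply le_of_sq_le_sq' hw.le
    rw [← pow_mul]
    have : (a:ℝ)^4 ≤ (a:ℝ)^7 := pow_le_pow_right₀ ha1 (by norm_num)
    norm_num
    nlinarith [pow_pos ha0 7]
  obtain ⟨j, hj⟩ : ∃ j, a = k + j := ⟨a-k, by omega⟩
  have hj1 : 1 ≤ j := by omega
  have hc := congrArg (Nat.cast : ℕ → ℝ) (Nat.choose_mul (n := n) hka.le)
  push_cast at hc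
  have hnk : (n.choose k : ℝ) ≠ 0 := by exact_mod_cast (Nat.choose_pos (by omega)).ne'
  have hajk : a - k = j := by omega
  rw [hajk] at hc
  have hQ : ∃ Q : ℝ, 0 < Q ∧ (2:ℝ)^(a.choose 2) = 2^(k.choose 2) * Q ∧ (w^5)^j ≤ Q := by
    have hle : k.choose 2 ≤ a.choose 2 := Nat.choose_le_choose 2 hka.le
    refine ⟨2^(a.choose 2 - k.choose 2), by positivity, by rw [← pow_add]; congr 1; omega, ?_⟩
    apply le_of_sq_le_sq' (by positivity)
    obtain ⟨m, rfl⟩ : ∃ m, k = m + 1 := ⟨k-1, by omega⟩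
    have e : (a.choose 2 - (m+1).choose 2) * 2 = (a + m) * j := by
      have h1 := ch2 m
      have h2 := ch2 (m + j)
      have h3 : m + j + 1 = a := by omega
      rw [h3] at h2
      have h4 : a * (m + j) = (m+1)*m + (a+m)*j := by rw [← h3]; ring
      omega
    have e1 : ((2:ℝ)^(a.choose 2 - (m+1).choose 2))^2 = (2^(a+m))^j := by rw [← pow_mul, e, pow_mul]
    have e2 : ((w^5)^j)^2 = (w^10)^j := by ring
    rw [e1, e2]
    apply pow_le_pow_left₀ (by positivity)
    rw [pow_add]
    norm_num at hsm ⊢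
    calc w^10 = w^6 * n := by rw [hn]; ring
      _ ≤ _ := mul_le_mul h2w hsm (by positivity) (by positivity)
  obtain ⟨Q, hQ0, hQ1, hQ2⟩ := hQ
  have h1 : (a.choose k : ℝ) ≤ (a:ℝ)^j := by
    rw [← Nat.choose_symm hka.le, hajk]
    exact_mod_cast Nat.choose_le_pow a j
  have h2 : ((n-k).choose j : ℝ) ≤ (n:ℝ)^j := by
    have : (n-k).choose j ≤ n^j := (Nat.choose_le_pow _ _).trans (Nat.pow_le_pow_left (Nat.sub_le _ _) _)
    exact_mod_cast this
  calc _ = (a.choose k : ℝ) * ((n-k).choose j) / Q := by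
        rw [inv_pow, hQ1]
        field_simp
        linear_combination (a.choose k : ℝ) * hc
    _ ≤ (a:ℝ)^j * (n:ℝ)^j / (w^5)^j := by
        apply div_le_div₀ (by positivity) _ (by positivity) hQ2
        apply mul_le_mul h1 h2 (by positivity) (by positivity)
    _ = (a/w)^j := by
        rw [← mul_pow, ← div_pow, hn]; congr 1; field_simp
    _ ≤ (a/w)^1 := by
        apply pow_le_pow_of_le_one (by positivity) _ hj1
        rw [div_le_one hw]; nlinarith
    _ ≤ 1 / a := by
        rw [pow_one, div_le_div_iff₀ hw ha0]; nlinarith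

lemma del_bound (n a : ℕ) (w : ℝ) (hw : 0 < w) (hn : (n:ℝ) = w ^ 4) (ha7 : 4 * (a:ℝ)^7 ≤ w^2)
    (h2w : w ^ 6 ≤ 2 ^ a) (h2 : 2 ≤ a) (h2a : 2 * a ≤ n)
    (hμ : (n.choose a : ℝ) * 2⁻¹ ^ (a.choose 2) ≤ w ^ 2) :
    ((n.choose a : ℝ) * 2⁻¹ ^ (a.choose 2)) * del n a ≤ 2 := by
  have ha0 : (0:ℝ) < a := by exact_mod_cast (by omega : 0 < a)
  have hna : (n.choose a : ℝ) ≠ 0 := by exact_mod_cast (Nat.choose_pos (by omega)).ne'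
  rw [del, Finset.mul_sum, ← Finset.insert_Icc_sub_one_right_eq_Icc h2,
    Finset.sum_insert (by simp; omega)]
  have e1 : ((n.choose a : ℝ) * 2⁻¹ ^ (a.choose 2)) * ((a.choose a : ℝ) ^ 2 * 2 ^ (a.choose 2) / (n.choose a)) = 1 := by
    rw [Nat.choose_self, inv_pow]; field_simp; norm_num
  rw [e1]
  have : ∑ k ∈ Finset.Icc 2 (a-1), ((n.choose a : ℝ) * 2⁻¹ ^ (a.choose 2)) * ((a.choose k : ℝ) ^ 2 * 2 ^ (k.choose 2) / (n.choose k))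
      ≤ ∑ k ∈ Finset.Icc 2 (a-1), 1 / (a:ℝ) := by
    apply Finset.sum_le_sum
    intro k hk
    have hk := Finset.mem_Icc.1 hk
    rcases le_total ((2:ℝ)^(k-1)) n with h | h
    · exact small_case n a k w _ hw hn ha7 hμ hk.1 (by omega) h2a h
    · exact large_case n a k w hw hn ha7 h2w hk.1 (by omega) h2a h
  rw [Finset.sum_const, nsmul_eq_mul, Nat.card_Icc] at this
  have h3 : ((a - 1 + 1 - 2 : ℕ) : ℝ) ≤ a := by exact_mod_cast (by omega : a - 1 + 1 - 2 ≤ a)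
  have : ((a - 1 + 1 - 2 : ℕ) : ℝ) * (1 / a) ≤ 1 := by
    rw [mul_one_div, div_le_one ha0]; exact h3
  linarith

lemma aa_facts : ∀ᶠ n : ℕ in atTop, 4 * (aa n : ℝ)^7 ≤ (n:ℝ)^((1:ℝ)/2) ∧
    (n:ℝ)^((3:ℝ)/2) ≤ 2 ^ (aa n) ∧ 2 ≤ aa n ∧ 2 * aa n ≤ n := by
  have hL : Tendsto (fun n : ℕ => Real.logb 2 n) atTop atTop :=
    (Real.tendsto_logb_atTop (by norm_num)).comp tendsto_natCast_atTop_atTop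
  have hlog2 : 0 < Real.log 2 := Real.log_pos (by norm_num)
  have f1 : ∀ᶠ x : ℝ in atTop, Real.logb 2 x ≤ x / 4 := by
    have := Real.isLittleO_log_id_atTop.bound (c := Real.log 2 / 4) (by positivity)
    filter_upwards [this, eventually_ge_atTop 1] with x hx hx1
    rw [Real.logb, div_le_iff₀ hlog2]
    simp only [id, Real.norm_eq_abs] at hx
    rw [abs_of_nonneg (by linarith : (0:ℝ) ≤ x)] at hx
    linarith [le_abs_self (Real.log x)]
  have f2 : ∀ᶠ x : ℝ in atTop, 4 * (3 * Real.logb 2 x)^7 ≤ x^((1:ℝ)/2) := by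
    have h := (isLittleO_log_rpow_rpow_atTop (s := 1/2) 7 (by norm_num)).bound
      (c := (4 * (3 / Real.log 2)^7)⁻¹) (by positivity)
    filter_upwards [h, eventually_ge_atTop 1] with x hx hx1
    have hl : 0 ≤ Real.log x := Real.log_nonneg hx1
    rw [Real.norm_of_nonneg (by positivity), Real.norm_of_nonneg (by positivity),
      show (7:ℝ) = ((7:ℕ):ℝ) by norm_num, Real.rpow_natCast] at hx
    rw [← div_eq_inv_mul, le_div_iff₀ (by positivity)] at hx
    rw [Real.logb]
    calc _ = Real.log x ^ 7 * (4 * (3 / Real.log 2)^7) := by ring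
      _ ≤ _ := hx
  filter_upwards [hL.eventually f1, hL.eventually (eventually_ge_atTop 4),
    tendsto_natCast_atTop_atTop.eventually f2, eventually_ge_atTop 2] with n h1 h2 h3 h4
  have hn1 : (2:ℝ) ≤ n := by exact_mod_cast h4
  have hn0 : (0:ℝ) < n := by linarith
  set L := Real.logb 2 n with hLdef
  have hLL : 0 ≤ Real.logb 2 L := Real.logb_nonneg (by norm_num) (by linarith)
  have he0 : 0 ≤ Real.logb 2 (Real.exp 1 / 2) := by
    apply Real.logb_nonneg (by norm_num)
    have := Real.exp_one_gt_d9
    linarith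
  have he1 : Real.logb 2 (Real.exp 1 / 2) ≤ 1/2 := by
    rw [Real.logb, div_le_iff₀ hlog2, Real.log_div (Real.exp_pos 1).ne' (by norm_num), Real.log_exp]
    have := Real.log_two_gt_d9
    linarith
  have hα1 : 3/2 * L + 1 ≤ alpha0 n := by rw [alpha0]; linarith
  have hα2 : alpha0 n ≤ 3 * L := by rw [alpha0]; linarith
  have ha1 : 3/2 * L ≤ aa n := by
    have := Nat.lt_floor_add_one (alpha0 n)
    rw [aa]; linarith
  have ha2 : (aa n : ℝ) ≤ 3 * L := (Nat.floor_le (by linarith)).trans hα2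
  have ha7 : 4 * (aa n : ℝ)^7 ≤ (n:ℝ)^((1:ℝ)/2) := by
    refine le_trans ?_ h3
    gcongr
  have ha2' : (2:ℝ) ≤ aa n := by linarith
  refine ⟨ha7, ?_, by exact_mod_cast ha2', ?_⟩
  · rw [← Real.rpow_natCast]
    calc (n:ℝ)^((3:ℝ)/2) = ((2:ℝ)^L)^((3:ℝ)/2) := by
          rw [hLdef, Real.rpow_logb (by norm_num) (by norm_num) hn0]
      _ = (2:ℝ)^(3/2*L) := by rw [← Real.rpow_mul (by norm_num), mul_comm]
      _ ≤ _ := Real.rpow_le_rpow_of_exponent_le (by norm_num) ha1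
  · have h5 : (n:ℝ)^((1:ℝ)/2) ≤ n := by
      conv_rhs => rw [← Real.rpow_one (n:ℝ)]
      exact Real.rpow_le_rpow_of_exponent_le (by linarith) (by norm_num)
    have h6 : (aa n : ℝ) ≤ (aa n : ℝ)^7 := le_self_pow₀ (by linarith) (by norm_num)
    have : 2 * (aa n : ℝ) ≤ n := by linarith
    exact_mod_cast this

lemma Pr_mono (n : ℕ) {B C : SimpleGraph (Fin n) → Prop} (h : ∀ G, B G → C G) : Pr n B ≤ Pr n C := by
  rw [Pr, Pr]
  apply div_le_div_of_nonneg_right _ (by positivity)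
  exact_mod_cast Nat.card_le_card_of_injective (Subtype.map id h) (Subtype.map_injective h Function.injective_id)

lemma Pr_disj (n : ℕ) {B C : SimpleGraph (Fin n) → Prop} (h : ∀ G, B G → ¬ C G) : Pr n B + Pr n C ≤ 1 := by
  classical
  rw [Pr, Pr, ← add_div]
  apply div_le_one_of_le₀ _ (by positivity)
  rw [Nat.card_eq_fintype_card, Nat.card_eq_fintype_card, Nat.card_eq_fintype_card]
  rw [Fintype.card_subtype, Fintype.card_subtype]
  norm_cast
  rw [← Finset.card_union_of_disjoint]
  · exact Finset.card_le_univ _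
  · rw [Finset.disjoint_filter]; intro G _; exact h G

/-- Key lemma: if `[s_n, t_n]` contains `χ(G(n,1/2))` whp and
`s_n = f(n) + o(n/log²n)`, then for large `n` with `n^ε ≤ μ(n) ≤ n^{1/2−ε}`,
letting `r = ⌊n^{x(n)/2}⌋` and `n′ = n + r·a(n)`, we have
`t_n − s_n ≥ s_{n′} − s_n − r`. -/
theorem stmt14 (ε : ℝ) (hε : 0 < ε) (hε4 : ε < 1/4) (s t : ℕ → ℝ)
    (hst : Tendsto (fun n : ℕ => Pr n (fun G => (chi n G : ℝ) ∈ Set.Icc (s n) (t n)))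
      atTop (nhds 1))
    (hs : Tendsto (fun n : ℕ => (s n - f n) * (Real.log n) ^ 2 / n) atTop (nhds 0)) :
    ∃ N : ℕ, ∀ n ≥ N, (n : ℝ) ^ ε ≤ mu n → mu n ≤ (n : ℝ) ^ ((1:ℝ)/2 - ε) →
      let r : ℕ := ⌊(n : ℝ) ^ (xx n / 2)⌋₊
      let n' : ℕ := n + r * aa n
      t n - s n ≥ s n' - s n - r := by
  have hP : ∀ᶠ n : ℕ in atTop,
      0.9 < Pr n (fun G => (chi n G : ℝ) ∈ Set.Icc (s n) (t n)) :=
    hst.eventually (lt_mem_nhds (by norm_num))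
  obtain ⟨N, hN⟩ := eventually_atTop.1 ((hP.and aa_facts).and (eventually_ge_atTop 2))
  refine ⟨N, ?_⟩
  intro n hn hm1 hm2
  intro r n'
  obtain ⟨⟨hp, ha7, h2a, ha2, han⟩, hn2⟩ := hN n hn
  have hp' := (hN n' (hn.le.trans (Nat.le_add_right _ _))).1.1
  have hn1 : (1:ℝ) < n := by exact_mod_cast (by omega : 1 < n)
  have hn0 : (0:ℝ) < n := by linarith
  have hmu0 : 0 < mu n := lt_of_lt_of_le (Real.rpow_pos_of_pos hn0 _) hm1
  have hr : (r:ℝ)^2 ≤ mu n := by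
    have h1 : (r:ℝ) ≤ (n:ℝ)^(xx n / 2) := Nat.floor_le (Real.rpow_nonneg hn0.le _)
    calc (r:ℝ)^2 ≤ ((n:ℝ)^(xx n / 2))^2 := by gcongr
      _ = (n:ℝ)^(xx n) := by
          rw [← Real.rpow_natCast, ← Real.rpow_mul hn0.le]; congr 1; push_cast; ring
      _ = mu n := by
          rw [Real.rpow_def_of_pos hn0, xx, mul_div_cancel₀ _ (Real.log_pos hn1).ne',
            Real.exp_log hmu0]
  have hw : 0 < (n:ℝ)^((1:ℝ)/4) := Real.rpow_pos_of_pos hn0 _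
  have hpw : ∀ k : ℕ, ((n:ℝ)^((1:ℝ)/4))^k = (n:ℝ)^((k:ℝ)/4) := by
    intro k
    rw [← Real.rpow_natCast, ← Real.rpow_mul hn0.le]; congr 1; ring
  have hw4 : (n:ℝ) = ((n:ℝ)^((1:ℝ)/4))^4 := by rw [hpw]; norm_num
  have hw2 : ((n:ℝ)^((1:ℝ)/4))^2 = (n:ℝ)^((1:ℝ)/2) := by rw [hpw]; norm_num
  have hw6 : ((n:ℝ)^((1:ℝ)/4))^6 = (n:ℝ)^((3:ℝ)/2) := by rw [hpw]; norm_num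
  have hd : mu n * del n (aa n) ≤ 2 := by
    apply del_bound n (aa n) _ hw hw4 (by rw [hw2]; exact ha7) (by rw [hw6]; exact h2a) ha2 han
    rw [hw2]
    refine hm2.trans (Real.rpow_le_rpow_of_exponent_le hn1.le (by linarith))
  have hd0 : 0 ≤ del n (aa n) := Finset.sum_nonneg (fun k _ => by positivity)
  have hrd : (r:ℝ) * Real.sqrt (del n (aa n)) ≤ 1.5 := by
    apply le_of_sq_le_sq' (by norm_num)
    rw [mul_pow, Real.sq_sqrt hd0]
    have := mul_le_mul_of_nonneg_right hr hd0
    norm_num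
    linarith
  by_contra hcon
  have hcon : t n < s n' - r := by
    push Not at hcon
    linarith
  have hit := iter (aa n) n (by omega) r (s n' - r)
  rw [sub_add_cancel, ← Pr_eq_q, ← Pr_eq_q] at hit
  have h1 : Pr n' (fun G => (chi n' G : ℝ) ∈ Set.Icc (s n') (t n')) ≤
      Pr n' (fun G => s n' ≤ chi n' G) := Pr_mono n' (fun G h => h.1)
  have h2 : Pr n (fun G => (chi n G : ℝ) ∈ Set.Icc (s n) (t n)) +
      Pr n (fun G => s n' - r ≤ chi n G) ≤ 1 := by
    apply Pr_disj
    intro G h h'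
    have := h.2
    linarith
  change Pr n' _ ≤ _ at hit
  have : Pr n' (fun G => s n' ≤ chi n' G) ≤ Pr n (fun G => s n' - r ≤ chi n G) + 0.75 := by
    linarith
  norm_num at *
  linarith
end
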